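/- arXiv:math/0403370 — 2 statements merged into one kernel-verified Lean document; each statement's English description precedes it below -/
import Mathlib

section
/- Let k be a field of characteristic zero, J a homogeneous prime ideal of a polynomial ring k[x_1, …, x_p], R = k[x_1, …, x_p]/J, m the maximal homogeneous ideal of R, d = dim R, and assume depth(R_m) ≥ 2 and that R is Gorenstein. Then for every homogeneous ideal I ⊆ R, lim_{n→∞} λ(H^0_m(R/I^n))/n^d = lim_{n→∞} λ(Ext^d_R(R/I^n, R(−d)))/n^d. -/
/-!
STATEMENT 2: Let `k` be a field of characteristic zero, `J` a homogeneous prime ideal of a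
polynomial ring `k[x_1, …, x_p]`, `R = k[x_1, …, x_p]/J`, `m` the maximal homogeneous ideal of
`R`, `d = dim R`; assume `depth(R_m) ≥ 2` and that `R` is Gorenstein.  Then for every
homogeneous ideal `I ⊆ R`,
`lim_{n→∞} λ(H⁰_m(R/Iⁿ))/n^d = lim_{n→∞} λ(Ext^d_R(R/Iⁿ, R(−d)))/n^d`.

`R` is modelled as a finitely generated standard ℕ-graded `k`-algebra domain.  `depth(R_m) ≥ 2`
is expressed as the existence of a length-two regular sequence on `R` inside `m`.
The Gorenstein property of (the local ring of) `R` at its maximal homogeneous ideal is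
expressed by the Bass characterization: `dim_k Ext^i_R(R/m, R) = δ_{i,d}`.
The twist `R(−d)` is, as an abstract `R`-module, just `R`, and the length of the Ext module
is unaffected by the twist.
-/

open Filter

/-- The zeroth local cohomology module `H⁰_J(M) = {x ∈ M | ∃ n, Jⁿ • x = 0}`. -/
noncomputable def H0 {R M : Type*} [CommRing R] [AddCommGroup M] [Module R M]
    (J : Ideal R) : Submodule R M :=
  ⨆ n : ℕ, Submodule.torsionBySet R M (J ^ n : Ideal R)

/-- The length of a module over a `k`-algebra, computed as its `k`-vector-space dimension. -/
noncomputable def kLength (k : Type*) {R : Type*} [Field k] [CommRing R] [Algebra k R]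
    (M : ModuleCat R) : ℕ :=
  Module.finrank k ((ModuleCat.restrictScalars (algebraMap k R)).obj M)

/-- `Ext^i_R(M, N)` as an object of `ModuleCat R`. -/
noncomputable def extModule (R : Type) [CommRing R] (i : ℕ)
    (M N : ModuleCat R) : ModuleCat R :=
  ((Ext R (ModuleCat R) i).obj (Opposite.op M)).obj N


section ExtCompare
open CategoryTheory

lemma smul_extMk' {R : Type} [CommRing R] {X Y : ModuleCat.{0} R} (P : ProjectiveResolution X)
    {n : ℕ} (f : P.complex.X n ⟶ Y) (r : R) (m : ℕ) (hm : n + 1 = m)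
    (hf : P.complex.d m n ≫ f = 0) :
    r • P.extMk f m hm hf = P.extMk (r • f) m hm (by simp [hf]) := by
  rw [Abelian.Ext.smul_eq_comp_mk₀, P.extMk_comp_mk₀]
  congr 1

/-- Comparison between the two versions of `Ext` in Mathlib, in positive degree. -/
lemma extModule_equiv {R : Type} [CommRing R] (p : ℕ) (M N : ModuleCat.{0} R) :
    Nonempty (extModule R (p + 1) M N ≃ₗ[R] Abelian.Ext M N (p + 1)) := by
  let P : ProjectiveResolution M := projectiveResolution M
  let K := P.complex.linearYonedaObj R N
  let S := K.sc' p (p + 1) (p + 2)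
  have e1 : extModule R (p + 1) M N ≅ S.moduleCatLeftHomologyData.H :=
    P.isoExt (p + 1) N ≪≫ K.homologyIsoSc' p (p+1) (p+2) (by simp) (by simp) ≪≫
      S.moduleCatHomologyIso
  let φ : LinearMap.ker S.g.hom →ₗ[R] Abelian.Ext M N (p + 1) :=
    { toFun := fun f => P.extMk (n := p + 1) (show P.complex.X (p + 1) ⟶ N from f.1) (p + 2) rfl
        (by exact f.2)
      map_add' := by
        intro f g
        exact (P.add_extMk _ _ _ _ _ _).symm
      map_smul' := by
        intro r f
        exact (smul_extMk' P _ r _ _ _).symm }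
  have hs : Function.Surjective φ := by
    intro α
    obtain ⟨f, hf, rfl⟩ := P.extMk_surjective α (p + 2) rfl
    exact ⟨⟨f, hf⟩, rfl⟩
  have hk : LinearMap.ker φ = LinearMap.range S.moduleCatToCycles := by
    ext f
    rw [LinearMap.mem_ker]
    refine (P.extMk_eq_zero_iff (show P.complex.X (p + 1) ⟶ N from f.1) (p + 2) rfl
      (by exact f.2) p rfl).trans ?_
    constructor
    · rintro ⟨g, hg⟩
      exact ⟨g, Subtype.ext hg⟩
    · rintro ⟨g, hg⟩
      exact ⟨g, congrArg Subtype.val hg⟩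
  have e2 : S.moduleCatLeftHomologyData.H ≃ₗ[R] Abelian.Ext M N (p + 1) :=
    (Submodule.quotEquivOfEq _ _ hk.symm).trans (φ.quotKerEquivOfSurjective hs)
  exact ⟨e1.toLinearEquiv.trans e2⟩

end ExtCompare


section LengthBridge

lemma length_bridge {k R : Type*} [Field k] [CommRing R] [Algebra k R] (m : Ideal R)
    (hsurj : ∀ r : R, ∃ c : k, r - algebraMap k R c ∈ m) (s : ℕ) :
    ∀ (N : Type) [AddCommGroup N] [Module R N] [Module k N] [IsScalarTower k R N],
    (∀ a ∈ m ^ s, ∀ x : N, a • x = 0) → Module.length k N = Module.length R N := by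
  induction s with
  | zero =>
    intro N _ _ _ _ h
    have : Subsingleton N := ⟨fun x y => by
      rw [← one_smul R x, ← one_smul R y, h 1 (by simp), h 1 (by simp)]⟩
    simp
  | succ s ih =>
    intro N _ _ _ _ h
    let N' : Submodule R N := m • ⊤
    have h1 : Module.length k N' = Module.length R N' := by
      apply ih
      rintro a ha ⟨x, hx⟩
      apply Subtype.ext
      change a • x = 0
      refine Submodule.smul_induction_on hx ?_ ?_
      · intro r hr n _
        rw [smul_smul]
        exact h _ (by rw [pow_succ]; exact Ideal.mul_mem_mul ha hr) _
      · intro x y hx hy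
        rw [smul_add, hx, hy, add_zero]
    have h2 : Module.length k (N ⧸ N') = Module.length R (N ⧸ N') := by
      rw [Module.length_eq_of_surjective (S := R) (R := R ⧸ m) (M := N ⧸ N')
        Ideal.Quotient.mk_surjective]
      have : IsScalarTower k (R ⧸ m) (N ⧸ N') := by
        constructor
        intro c x y
        obtain ⟨x, rfl⟩ := Ideal.Quotient.mk_surjective x
        obtain ⟨y, rfl⟩ := Submodule.mkQ_surjective _ y
        change Submodule.Quotient.mk ((c • x) • y) = c • Submodule.Quotient.mk (x • y)
        rw [smul_assoc]; rfl
      rw [Module.length_eq_of_surjective (S := k) (R := R ⧸ m) (M := N ⧸ N')]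
      intro x
      obtain ⟨x, rfl⟩ := Ideal.Quotient.mk_surjective x
      obtain ⟨c, hc⟩ := hsurj x
      exact ⟨c, (Ideal.Quotient.eq.mpr hc).symm⟩
    rw [Module.length_eq_add_of_exact N'.subtype N'.mkQ N'.subtype_injective
      N'.mkQ_surjective (LinearMap.exact_subtype_mkQ N'),
      Module.length_eq_add_of_exact (N'.subtype.restrictScalars k) (N'.mkQ.restrictScalars k)
      N'.subtype_injective N'.mkQ_surjective (LinearMap.exact_subtype_mkQ N'), h1, h2]

lemma finrank_eq_toNat_length {k N : Type*} [Field k] [AddCommGroup N] [Module k N] :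
    Module.finrank k N = (Module.length k N).toNat := by
  rw [Module.length_eq_rank]
  simp [Module.finrank]

lemma kLength_eq {k R : Type} [Field k] [CommRing R] [Algebra k R] (m : Ideal R)
    (hsurj : ∀ r : R, ∃ c : k, r - algebraMap k R c ∈ m) (s : ℕ) (M : ModuleCat.{0} R)
    (hM : ∀ a ∈ m ^ s, ∀ x : M, a • x = 0) : kLength k M = (Module.length R M).toNat := by
  let N := (ModuleCat.restrictScalars (algebraMap k R)).obj M
  let _ : Module R N := inferInstanceAs (Module R M)
  have : IsScalarTower k R N := ⟨fun c r x => by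
    rw [Algebra.smul_def, mul_smul]; rfl⟩
  unfold kLength
  rw [finrank_eq_toNat_length, length_bridge m hsurj s N hM]
  rfl

end LengthBridge


section Twist
open CategoryTheory

lemma ext_ann_twist {R : Type} [CommRing R] (φ : R ≃+* R) (M N : ModuleCat.{0} R)
    (eM : Nonempty ((ModuleCat.restrictScalars (φ : R →+* R)).obj M ≅ M))
    (eN : Nonempty ((ModuleCat.restrictScalars (φ : R →+* R)).obj N ≅ N)) (i : ℕ) (s : R)
    (hs : ∀ x : Abelian.Ext M N i, φ s • x = 0) : ∀ x : Abelian.Ext M N i, s • x = 0 := by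
  let F := ModuleCat.restrictScalars.{0} (φ : R →+* R)
  obtain ⟨eM⟩ := eM
  obtain ⟨eN⟩ := eN
  have : F.IsEquivalence :=
    (ModuleCat.restrictScalarsEquivalenceOfRingEquiv φ).isEquivalence_functor
  have hF : F.PreservesProjectiveObjects := by
    infer_instance
  have hb := F.mapExt_bijective_of_preservesProjectiveObjects M N i
  have key : ∀ x : Abelian.Ext (F.obj M) (F.obj N) i, s • x = 0 := by
    intro x
    obtain ⟨y, rfl⟩ := hb.2 x
    rw [Abelian.Ext.smul_eq_comp_mk₀]
    have : s • 𝟙 (F.obj N) = F.map (φ s • 𝟙 N) := rfl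
    rw [this, ← Abelian.Ext.mapExactFunctor_mk₀, Functor.mapExtAddHom_apply,
      ← Abelian.Ext.mapExactFunctor_comp, ← Abelian.Ext.smul_eq_comp_mk₀, hs]
    simp
  intro x
  have h2 : x = ((Abelian.Ext.mk₀ eM.inv).comp
     (((Abelian.Ext.mk₀ eM.hom).comp x (zero_add i)).comp (Abelian.Ext.mk₀ eN.inv) (add_zero i))
      (zero_add i)).comp (Abelian.Ext.mk₀ eN.hom) (add_zero i) := by
    simp
  rw [h2, ← Abelian.Ext.smul_comp, ← Abelian.Ext.comp_smul, key]
  simp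

lemma ext_ann_twist_quot {R : Type} [CommRing R] (φ : R ≃+* R) (I : Ideal R)
    (hI : ∀ x, φ x ∈ I ↔ x ∈ I) (i : ℕ) (s : R)
    (hs : ∀ x : Abelian.Ext (ModuleCat.of R (R ⧸ I)) (ModuleCat.of R R) i, φ s • x = 0) :
    ∀ x : Abelian.Ext (ModuleCat.of R (R ⧸ I)) (ModuleCat.of R R) i, s • x = 0 := by
  refine ext_ann_twist φ _ _ ?_ ?_ i s hs
  · let N := (ModuleCat.restrictScalars (φ : R →+* R)).obj (ModuleCat.of R (R ⧸ I))
    let f : R →ₗ[R] N :=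
      { toFun := fun r => (Ideal.Quotient.mk I (φ r) : R ⧸ I)
        map_add' := fun a b => by rw [map_add, map_add]; rfl
        map_smul' := fun a b => by
          rw [smul_eq_mul, map_mul, map_mul]; rfl }
    have hf : Function.Surjective f := by
      intro x
      obtain ⟨r, hr⟩ := Ideal.Quotient.mk_surjective (I := I) x
      exact ⟨φ.symm r, by change Ideal.Quotient.mk I (φ (φ.symm r)) = x; simpa using hr⟩
    have hk : LinearMap.ker f = I := by
      ext x
      rw [← hI x, LinearMap.mem_ker]
      exact Ideal.Quotient.eq_zero_iff_mem
    exact ⟨(LinearEquiv.toModuleIso ((Submodule.quotEquivOfEq _ _ hk.symm).trans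
      (f.quotKerEquivOfSurjective hf))).symm⟩
  · let N := (ModuleCat.restrictScalars (φ : R →+* R)).obj (ModuleCat.of R R)
    let f : R →ₗ[R] N :=
      { toFun := fun r => (φ r : R)
        map_add' := fun a b => by rw [map_add]; rfl
        map_smul' := fun a b => by
          rw [smul_eq_mul, map_mul]; rfl }
    exact ⟨(LinearEquiv.toModuleIso (LinearEquiv.ofBijective f φ.bijective)).symm⟩

end Twist

section Scaling
variable {k R : Type} [Field k] [CommRing R] [Algebra k R]
    (𝒜 : ℕ → Submodule k R) [GradedAlgebra 𝒜]

/-- The endomorphism scaling degree `i` by `t ^ i`. -/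
noncomputable def scaleHom (t : k) : R →ₐ[k] R :=
  (DirectSum.toAlgebra k (fun i => 𝒜 i) (fun i => t ^ i • (𝒜 i).subtype)
    (by simp) (by
      intro i j a b
      change t ^ (i + j) • ((a : R) * b) = (t ^ i • (a : R)) * (t ^ j • (b : R))
      rw [smul_mul_smul_comm, pow_add])).comp
  (DirectSum.decomposeAlgEquiv 𝒜).toAlgHom

lemma scaleHom_of_mem (t : k) {i : ℕ} {x : R} (hx : x ∈ 𝒜 i) : scaleHom 𝒜 t x = t ^ i • x := by
  simp only [scaleHom, AlgHom.comp_apply]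
  change DirectSum.toAlgebra k (fun i => 𝒜 i) _ _ _ (DirectSum.decompose 𝒜 x) = _
  rw [DirectSum.decompose_of_mem 𝒜 hx]
  exact (DirectSum.toAddMonoid_of (β := fun i => 𝒜 i)
    (fun i => (t ^ i • (𝒜 i).subtype : 𝒜 i →ₗ[k] R).toAddMonoidHom) i ⟨x, hx⟩).trans rfl

lemma scaleHom_comp (s t : k) (x : R) : scaleHom 𝒜 s (scaleHom 𝒜 t x) = scaleHom 𝒜 (s * t) x := by
  induction x using DirectSum.Decomposition.inductionOn 𝒜 with
  | zero => simp
  | homogeneous a =>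
    rw [scaleHom_of_mem 𝒜 t a.2, map_smul, scaleHom_of_mem 𝒜 s a.2, scaleHom_of_mem 𝒜 _ a.2,
      smul_smul, mul_pow, mul_comm]
  | add a b ha hb => simp [ha, hb]

lemma scaleHom_one (x : R) : scaleHom 𝒜 1 x = x := by
  induction x using DirectSum.Decomposition.inductionOn 𝒜 with
  | zero => simp
  | homogeneous a => rw [scaleHom_of_mem 𝒜 1 a.2]; simp
  | add a b ha hb => simp [ha, hb]

/-- The automorphism scaling degree `i` by `t ^ i`. -/
noncomputable def scaleEquiv (t : k) (ht : t ≠ 0) : R ≃+* R :=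
  RingEquiv.ofRingHom (scaleHom 𝒜 t : R →+* R) (scaleHom 𝒜 t⁻¹ : R →+* R)
    (by ext x; simp [scaleHom_comp, ht, scaleHom_one])
    (by ext x; simp [scaleHom_comp, ht, scaleHom_one])

open Classical in
lemma scaleHom_eq_sum (t : k) (x : R) :
    scaleHom 𝒜 t x = ∑ i ∈ (DirectSum.decompose 𝒜 x).support,
      t ^ i • (DirectSum.decompose 𝒜 x i : R) := by
  conv_lhs => rw [← DirectSum.sum_support_decompose 𝒜 x, map_sum]
  exact Finset.sum_congr rfl fun i _ => scaleHom_of_mem 𝒜 t (SetLike.coe_mem _)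

lemma scaleHom_mem (t : k) {I : Ideal R} (hI : I.IsHomogeneous 𝒜) {x : R} (hx : x ∈ I) :
    scaleHom 𝒜 t x ∈ I := by
  rw [scaleHom_eq_sum]
  refine I.sum_mem fun i _ => ?_
  exact Submodule.smul_of_tower_mem I _ (hI i hx)

lemma scale_component_zero [CharZero k] (A : Ideal R)
    (hA : ∀ t : k, t ≠ 0 → ∀ x, x ∈ A → scaleHom 𝒜 t x ∈ A) {x : R} (hx : x ∈ A) :
    (DirectSum.decompose 𝒜 x 0 : R) ∈ A := by
  classical
  obtain ⟨n, hn⟩ : ∃ n : ℕ, ∀ i ∈ (DirectSum.decompose 𝒜 x).support, i < n :=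
    ⟨(DirectSum.decompose 𝒜 x).support.sup id + 1, fun i hi =>
      Nat.lt_succ_of_le (Finset.le_sup (f := id) hi)⟩
  let v : ℕ → k := fun j => (j : k) + 1
  have hv : Set.InjOn v (Finset.range n : Set ℕ) := fun a _ b _ h => by
    simpa [v] using h
  have hL : ∀ i < n, ∑ j ∈ Finset.range n, (v j) ^ i * ((Lagrange.basis (Finset.range n) v j).eval 0)
      = (0 : k) ^ i := by
    intro i hi
    have := Lagrange.eq_interpolate_of_eval_eq (s := Finset.range n) (v := v)
      (f := (Polynomial.X ^ i : Polynomial k)) (fun j => (v j) ^ i) hv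
      (by
        rw [Polynomial.degree_X_pow, Finset.card_range]; exact_mod_cast hi)
      (by simp)
    have h2 := congrArg (Polynomial.eval 0) this
    simp only [Lagrange.interpolate_apply, Polynomial.eval_finsetSum, Polynomial.eval_mul,
      Polynomial.eval_C, Polynomial.eval_pow, Polynomial.eval_X] at h2
    exact h2.symm
  have key : (DirectSum.decompose 𝒜 x 0 : R) = ∑ j ∈ Finset.range n,
      ((Lagrange.basis (Finset.range n) v j).eval 0) • scaleHom 𝒜 (v j) x := by
    simp_rw [scaleHom_eq_sum, Finset.smul_sum]
    rw [Finset.sum_comm]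
    have : ∀ i ∈ (DirectSum.decompose 𝒜 x).support, ∑ j ∈ Finset.range n,
      ((Lagrange.basis (Finset.range n) v j).eval 0) • (v j) ^ i •
        (DirectSum.decompose 𝒜 x i : R) = (0 : k) ^ i • (DirectSum.decompose 𝒜 x i : R) := by
      intro i hi
      rw [← hL i (hn i hi), Finset.sum_smul]
      refine Finset.sum_congr rfl fun j _ => ?_
      rw [smul_smul, mul_comm]
    rw [Finset.sum_congr rfl this]
    by_cases h0 : 0 ∈ (DirectSum.decompose 𝒜 x).support
    · rw [Finset.sum_eq_single_of_mem 0 h0]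
      · simp
      · intro b _ hb; simp [hb]
    · rw [Finset.sum_eq_zero]
      · simpa using h0
      · intro i hi
        have : i ≠ 0 := fun h => h0 (h ▸ hi)
        simp [this]
  rw [key]
  refine A.sum_mem fun j _ => Submodule.smul_of_tower_mem A _ (hA _ ?_ _ hx)
  exact Nat.cast_add_one_ne_zero j

end Scaling


section LES
open CategoryTheory
variable {R : Type} [CommRing R]

/-- `Ext^i_R(M, R)` -/
abbrev EX (R : Type) [CommRing R] (M : Type) [AddCommGroup M] [Module R M] (i : ℕ) : Type :=
  Abelian.Ext (ModuleCat.of R M) (ModuleCat.of R R) i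

variable {M M' M'' : Type} [AddCommGroup M] [Module R M] [AddCommGroup M'] [Module R M']
  [AddCommGroup M''] [Module R M'']

/-- Functoriality of `Ext^i(-, R)`. -/
noncomputable def exMap (i : ℕ) (f : M →ₗ[R] M') : EX R M' i →ₗ[R] EX R M i :=
  (Abelian.Ext.mk₀ (ModuleCat.ofHom f)).precompOfLinear R (ModuleCat.of R R) (zero_add i)

lemma exMap_apply (i : ℕ) (f : M →ₗ[R] M') (x : EX R M' i) :
    exMap i f x = (Abelian.Ext.mk₀ (ModuleCat.ofHom f)).comp x (zero_add i) := rfl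

lemma exMap_smul_id (i : ℕ) (r : R) (x : EX R M i) :
    exMap i (r • (LinearMap.id : M →ₗ[R] M)) x = r • x := by
  rw [exMap_apply]
  have : ModuleCat.ofHom (r • (LinearMap.id : M →ₗ[R] M)) = r • 𝟙 (ModuleCat.of R M) := rfl
  rw [this, Abelian.Ext.mk₀_smul, Abelian.Ext.smul_comp]
  simp

lemma exMap_comp (i : ℕ) (f : M →ₗ[R] M') (g : M' →ₗ[R] M'') (x : EX R M'' i) :
    exMap i (g ∘ₗ f) x = exMap i f (exMap i g x) := by
  rw [exMap_apply, exMap_apply, exMap_apply, ModuleCat.ofHom_comp]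
  simp

lemma ex_subsingleton_of_equiv (i : ℕ) (e : M ≃ₗ[R] M') [Subsingleton (EX R M i)] :
    Subsingleton (EX R M' i) := by
  refine ⟨fun x y => ?_⟩
  have h : ∀ z : EX R M' i, exMap i e.symm.toLinearMap (exMap i e.toLinearMap z) = z := by
    intro z
    rw [← exMap_comp]
    have : e.toLinearMap ∘ₗ e.symm.toLinearMap = (1 : R) • LinearMap.id := by ext; simp
    rw [this, exMap_smul_id, one_smul]
  rw [← h x, ← h y, Subsingleton.elim (exMap i e.toLinearMap x) (exMap i e.toLinearMap y)]

/-- Ext of equivalent modules. -/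
noncomputable def exEquiv (i : ℕ) (e : M ≃ₗ[R] M') : EX R M i ≃ₗ[R] EX R M' i :=
  LinearEquiv.ofLinearMap (exMap i e.symm.toLinearMap) (exMap i e.toLinearMap)
    (by
      ext z
      rw [LinearMap.comp_apply, ← exMap_comp]
      have : e.toLinearMap ∘ₗ e.symm.toLinearMap = (1 : R) • LinearMap.id := by ext; simp
      rw [this, exMap_smul_id, one_smul]; rfl)
    (by
      ext z
      rw [LinearMap.comp_apply, ← exMap_comp]
      have : e.symm.toLinearMap ∘ₗ e.toLinearMap = (1 : R) • LinearMap.id := by ext; simp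
      rw [this, exMap_smul_id, one_smul]; rfl)

lemma ex_les (f : M' →ₗ[R] M) (g : M →ₗ[R] M'') (hf : Function.Injective f)
    (hg : Function.Surjective g) (hfg : Function.Exact f g) (i : ℕ) :
    Function.Exact (exMap i g) (exMap i f) ∧
    ∃ δ : EX R M' i →ₗ[R] EX R M'' (i + 1),
      Function.Exact (exMap i f) δ ∧ Function.Exact δ (exMap (i + 1) g) := by
  let S : ShortComplex (ModuleCat.{0} R) :=
    ShortComplex.mk (ModuleCat.ofHom f) (ModuleCat.ofHom g) (by
      ext x; exact hfg.apply_apply_eq_zero x)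
  have hS : S.ShortExact :=
    { exact := by
        rw [ShortComplex.ShortExact.moduleCat_exact_iff_function_exact]
        exact hfg
      mono_f := (ModuleCat.mono_iff_injective _).2 hf
      epi_g := (ModuleCat.epi_iff_surjective _).2 hg }
  refine ⟨?_, hS.extClass.precompOfLinear R (ModuleCat.of R R) (add_comm 1 i), ?_, ?_⟩
  · intro x
    constructor
    · intro h; exact Abelian.Ext.contravariant_sequence_exact₂ hS _ x h
    · rintro ⟨y, rfl⟩
      rw [← exMap_comp]
      have : g ∘ₗ f = 0 := by ext x; exact hfg.apply_apply_eq_zero x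
      rw [this, exMap_apply]
      simp [ModuleCat.ofHom_zero]
  · intro x
    constructor
    · intro h; exact Abelian.Ext.contravariant_sequence_exact₁ hS _ x (add_comm 1 i) h
    · rintro ⟨y, rfl⟩
      exact hS.extClass_comp_assoc y (h := add_comm 1 i)
  · intro x
    constructor
    · intro h; exact Abelian.Ext.contravariant_sequence_exact₃ hS _ x h (add_comm 1 i) 
    · rintro ⟨y, rfl⟩
      exact hS.comp_extClass_assoc y (add_comm 1 i)

instance ex_finite [IsNoetherianRing R] [Module.Finite R M] (i : ℕ) :
    Module.Finite R (EX R M i) := by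
  infer_instance

/-- the middle term vanishes if the outer terms do -/
lemma ex_mid (f : M' →ₗ[R] M) (g : M →ₗ[R] M'') (hf : Function.Injective f)
    (hg : Function.Surjective g) (hfg : Function.Exact f g) (i : ℕ)
    [Subsingleton (EX R M' i)] [Subsingleton (EX R M'' i)] : Subsingleton (EX R M i) := by
  have h := (ex_les f g hf hg hfg i).1
  refine ⟨fun x y => ?_⟩
  have h0 : ∀ x : EX R M i, x = 0 := by
    intro x
    obtain ⟨y, rfl⟩ := (h x).1 (Subsingleton.elim _ _)
    rw [Subsingleton.elim y 0, map_zero]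
  rw [h0 x, h0 y]

end LES


section GradedFacts
variable {k R : Type} [Field k] [CommRing R] [Algebra k R]
    (𝒜 : ℕ → Submodule k R) [GradedAlgebra 𝒜]

/-- the irrelevant ideal -/
abbrev irr : Ideal R := (HomogeneousIdeal.irrelevant 𝒜).toIdeal

lemma mem_irr {x : R} : x ∈ (irr 𝒜) ↔ (DirectSum.decompose 𝒜 x 0 : R) = 0 := by
  change x ∈ HomogeneousIdeal.irrelevant 𝒜 ↔ _
  rw [HomogeneousIdeal.mem_irrelevant_iff]
  rfl

lemma mem_irr_of_mem {x : R} {i : ℕ} (hi : i ≠ 0) (hx : x ∈ 𝒜 i) : x ∈ (irr 𝒜) := by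
  rw [mem_irr]; exact DirectSum.decompose_of_mem_ne 𝒜 hx hi

lemma decompose_sub_self_mem (x : R) : x - (DirectSum.decompose 𝒜 x 0 : R) ∈ (irr 𝒜) := by
  rw [mem_irr, DirectSum.decompose_sub]
  simp [DirectSum.decompose_coe]

lemma irr_surj (hstd : Algebra.adjoin k (𝒜 1 : Set R) = ⊤) (r : R) :
    ∃ c : k, r - algebraMap k R c ∈ (irr 𝒜) := by
  have hr : r ∈ Algebra.adjoin k (𝒜 1 : Set R) := by rw [hstd]; trivial
  induction hr using Algebra.adjoin_induction with
  | mem x hx => exact ⟨0, by simpa using mem_irr_of_mem 𝒜 one_ne_zero hx⟩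
  | algebraMap c => exact ⟨c, by simp⟩
  | add x y _ _ hx hy =>
    obtain ⟨a, ha⟩ := hx
    obtain ⟨b, hb⟩ := hy
    refine ⟨a + b, ?_⟩
    have := Ideal.add_mem _ ha hb
    convert this using 1
    rw [map_add]; ring
  | mul x y _ _ hx hy =>
    obtain ⟨a, ha⟩ := hx
    obtain ⟨b, hb⟩ := hy
    refine ⟨a * b, ?_⟩
    have := Ideal.add_mem _ (Ideal.mul_mem_right y _ ha)
      (Ideal.mul_mem_left _ (algebraMap k R a) hb)
    convert this using 1
    rw [map_mul]; ring

lemma irr_ne_top [Nontrivial R] : (irr 𝒜) ≠ ⊤ := by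
  rw [Ideal.ne_top_iff_one, mem_irr, DirectSum.decompose_of_mem_same 𝒜 SetLike.GradedOne.one_mem]
  exact one_ne_zero

lemma irr_maximal [Nontrivial R] (hstd : Algebra.adjoin k (𝒜 1 : Set R) = ⊤) : (irr 𝒜).IsMaximal := by
  rw [Ideal.isMaximal_iff]
  refine ⟨(Ideal.ne_top_iff_one _).1 (irr_ne_top 𝒜), fun J x hJ hx hxJ => ?_⟩
  obtain ⟨c, hc⟩ := irr_surj 𝒜 hstd x
  have hc0 : c ≠ 0 := by
    rintro rfl; apply hx; simpa using hc
  have h1 : algebraMap k R c ∈ J := by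
    have := J.sub_mem hxJ (hJ hc); simpa using this
  have h2 := J.mul_mem_left (algebraMap k R c⁻¹) h1
  rwa [← map_mul, inv_mul_cancel₀ hc0, map_one] at h2

lemma component_mem_pow (hstd : Algebra.adjoin k (𝒜 1 : Set R) = ⊤) (r : R) :
    ∀ i, (DirectSum.decompose 𝒜 r i : R) ∈ (Ideal.span (𝒜 1 : Set R)) ^ i := by
  classical
  have hr : r ∈ Algebra.adjoin k (𝒜 1 : Set R) := by rw [hstd]; trivial
  induction hr using Algebra.adjoin_induction with
  | mem x hx =>
    intro i
    by_cases hi : i = 1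
    · subst hi
      rw [DirectSum.decompose_of_mem_same 𝒜 hx, pow_one]
      exact Ideal.subset_span hx
    · rw [DirectSum.decompose_of_mem_ne 𝒜 hx (Ne.symm hi)]; exact zero_mem _
  | algebraMap c =>
    intro i
    by_cases hi : i = 0
    · subst hi; simp
    · rw [DirectSum.decompose_of_mem_ne 𝒜 (SetLike.algebraMap_mem_graded 𝒜 c) (Ne.symm hi)]
      exact zero_mem _
  | add x y _ _ hx hy =>
    intro i
    rw [DirectSum.decompose_add]
    exact Ideal.add_mem _ (hx i) (hy i)
  | mul x y _ _ hx hy =>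
    intro i
    rw [DirectSum.decompose_mul, DirectSum.coe_mul_apply]
    refine Ideal.sum_mem _ fun p hp => ?_
    rw [← (Finset.mem_filter.1 hp).2, pow_add]
    exact Ideal.mul_mem_mul (hx _) (hy _)

lemma irr_eq_span (hstd : Algebra.adjoin k (𝒜 1 : Set R) = ⊤) :
    (irr 𝒜) = Ideal.span (𝒜 1 : Set R) := by
  classical
  apply le_antisymm
  · intro x hx
    rw [← DirectSum.sum_support_decompose 𝒜 x]
    refine Ideal.sum_mem _ fun i _ => ?_
    by_cases hi : i = 0
    · subst hi; rw [(mem_irr 𝒜).1 hx]; exact zero_mem _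
    · exact Ideal.pow_le_self hi (component_mem_pow 𝒜 hstd x i)
  · rw [Ideal.span_le]; exact fun x hx => mem_irr_of_mem 𝒜 one_ne_zero hx

lemma mem_irr_pow (hstd : Algebra.adjoin k (𝒜 1 : Set R) = ⊤) {i : ℕ} {x : R} (hx : x ∈ 𝒜 i) :
    x ∈ (irr 𝒜) ^ i := by
  rw [irr_eq_span 𝒜 hstd]
  have := component_mem_pow 𝒜 hstd x i
  rwa [DirectSum.decompose_of_mem_same 𝒜 hx] at this

/-- graded Nakayama for Ext -/
lemma ex_nakayama [CharZero k] [Nontrivial R] [IsNoetherianRing R]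
    (I : Ideal R) (hI : I.IsHomogeneous 𝒜) (i : ℕ) (x : R) (hx : x ∈ (irr 𝒜))
    (h : ∀ e : EX R (R ⧸ I) i, ∃ e' : EX R (R ⧸ I) i, x • e' = e) :
    Subsingleton (EX R (R ⧸ I) i) := by
  have h1 : (⊤ : Submodule R (EX R (R ⧸ I) i)) ≤ (irr 𝒜) • ⊤ := by
    intro e _
    obtain ⟨e', rfl⟩ := h e
    exact Submodule.smul_mem_smul hx trivial
  obtain ⟨s, hs1, hs⟩ := Submodule.exists_sub_one_mem_and_smul_eq_zero_of_fg_of_le_smul (irr 𝒜) _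
    (Module.Finite.fg_top) h1
  let A : Ideal R := Module.annihilator R (EX R (R ⧸ I) i)
  have hA : ∀ t : k, t ≠ 0 → ∀ x, x ∈ A → scaleHom 𝒜 t x ∈ A := by
    intro t ht x hx
    rw [Module.mem_annihilator] at hx ⊢
    refine ext_ann_twist_quot (scaleEquiv 𝒜 t⁻¹ (inv_ne_zero ht)) I ?_ i _ ?_
    · intro y
      change scaleHom 𝒜 t⁻¹ y ∈ I ↔ _
      refine ⟨fun hy => ?_, scaleHom_mem 𝒜 _ hI⟩
      have := scaleHom_mem 𝒜 t hI hy
      rwa [scaleHom_comp, mul_inv_cancel₀ ht, scaleHom_one] at this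
    · change ∀ z, scaleHom 𝒜 t⁻¹ (scaleHom 𝒜 t x) • z = 0
      rw [scaleHom_comp, inv_mul_cancel₀ ht, scaleHom_one]
      exact hx
  have hsA : s ∈ A := by rw [Module.mem_annihilator]; exact fun e => hs e trivial
  have h0 := scale_component_zero 𝒜 A hA hsA
  have h2 : (DirectSum.decompose 𝒜 s 0 : R) = 1 := by
    have := (mem_irr 𝒜).1 hs1
    rw [DirectSum.decompose_sub, DirectSum.sub_apply, AddSubgroupClass.coe_sub,
      DirectSum.decompose_of_mem_same 𝒜 (SetLike.GradedOne.one_mem (A := 𝒜))] at this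
    exact sub_eq_zero.1 this
  rw [h2, Module.mem_annihilator] at h0
  exact ⟨fun a b => by rw [← one_smul R a, ← one_smul R b, h0, h0]⟩

end GradedFacts


section Bass

/-- multiplication by `x` as a map `R/J → R/I`, where `J = I : x` -/
noncomputable def colonMap {R : Type} [CommRing R] (I J : Ideal R) (x : R)
    (hJ : ∀ r, r ∈ J ↔ x * r ∈ I) : (R ⧸ J) →ₗ[R] (R ⧸ I) :=
  Submodule.mapQ J I (LinearMap.mulLeft R x) (fun r hr => (hJ r).1 hr)

lemma colonMap_mk {R : Type} [CommRing R] (I J : Ideal R) (x : R)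
    (hJ : ∀ r, r ∈ J ↔ x * r ∈ I) (r : R) :
    colonMap I J x hJ (Ideal.Quotient.mk J r) = Ideal.Quotient.mk I (x * r) := rfl

lemma colon_ses {R : Type} [CommRing R] (I J : Ideal R) (x : R)
    (hJ : ∀ r, r ∈ J ↔ x * r ∈ I) :
    Function.Injective (colonMap I J x hJ) ∧
    Function.Surjective (Submodule.factor (le_sup_left : I ≤ I ⊔ Ideal.span {x})) ∧
    Function.Exact (colonMap I J x hJ)
      (Submodule.factor (le_sup_left : I ≤ I ⊔ Ideal.span {x})) := by
  refine ⟨?_, Submodule.factor_surjective _, ?_⟩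
  · rw [injective_iff_map_eq_zero]
    intro a
    obtain ⟨r, rfl⟩ := Ideal.Quotient.mk_surjective a
    intro h
    rw [colonMap_mk, Ideal.Quotient.eq_zero_iff_mem] at h
    rw [Ideal.Quotient.eq_zero_iff_mem]
    exact (hJ r).2 h
  · intro a
    obtain ⟨r, rfl⟩ := Ideal.Quotient.mk_surjective a
    have h1 : Submodule.factor (le_sup_left : I ≤ I ⊔ Ideal.span {x}) (Ideal.Quotient.mk I r) = 0
      ↔ r ∈ I ⊔ Ideal.span {x} := by
      exact Ideal.Quotient.eq_zero_iff_mem (I := I ⊔ Ideal.span {x})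
    rw [h1, Submodule.mem_sup]
    constructor
    · rintro ⟨y, hy, z, hz, rfl⟩
      obtain ⟨w, rfl⟩ := Ideal.mem_span_singleton'.1 hz
      refine ⟨Ideal.Quotient.mk J w, ?_⟩
      rw [colonMap_mk, Ideal.Quotient.eq]
      have : x * w - (y + w * x) = -y := by ring
      rw [this]; exact I.neg_mem hy
    · rintro ⟨b, hb⟩
      obtain ⟨w, rfl⟩ := Ideal.Quotient.mk_surjective b
      rw [colonMap_mk, Ideal.Quotient.eq] at hb
      exact ⟨-(x * w - r), I.neg_mem hb, w * x, Ideal.mul_mem_left _ _ (Ideal.mem_span_singleton_self x),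
        by ring⟩

lemma ex_of_subsingleton {R : Type} [CommRing R] {M : Type} [AddCommGroup M] [Module R M]
    [Subsingleton M] (i : ℕ) : Subsingleton (EX R M i) := by
  have h : ∀ x : EX R M i, x = 0 := by
    intro x
    rw [← one_smul R x, ← exMap_smul_id,
      Subsingleton.elim ((1 : R) • (LinearMap.id : M →ₗ[R] M)) ((0 : R) • LinearMap.id),
      exMap_smul_id, zero_smul]
  exact ⟨fun x y => by rw [h x, h y]⟩

variable {k R : Type} [Field k] [CommRing R] [Algebra k R]
    (𝒜 : ℕ → Submodule k R) [GradedAlgebra 𝒜]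

lemma le_irr (hstd : Algebra.adjoin k (𝒜 1 : Set R) = ⊤)
    {I : Ideal R} (hI : I.IsHomogeneous 𝒜) (h : I ≠ ⊤) : I ≤ irr 𝒜 := by
  intro x hx
  rw [mem_irr]
  obtain ⟨c, hc⟩ := irr_surj 𝒜 hstd x
  rw [mem_irr, DirectSum.decompose_sub, DirectSum.sub_apply, AddSubgroupClass.coe_sub,
    DirectSum.decompose_of_mem_same 𝒜 (SetLike.algebraMap_mem_graded 𝒜 c), sub_eq_zero] at hc
  have h0 := hI 0 hx
  rw [hc] at h0 ⊢
  by_contra hne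
  apply h
  have hc0 : c ≠ 0 := by rintro rfl; simp at hne
  refine Ideal.eq_top_of_isUnit_mem _ h0 ?_
  exact (isUnit_iff_ne_zero.2 hc0).map (algebraMap k R)

lemma colon_homogeneous {I J : Ideal R} (hI : I.IsHomogeneous 𝒜) {x : R} {n : ℕ} (hx : x ∈ 𝒜 n)
    (hJ : ∀ r, r ∈ J ↔ x * r ∈ I) : J.IsHomogeneous 𝒜 := by
  intro i r hr
  rw [hJ] at hr ⊢
  have := hI (n + i) hr
  rwa [DirectSum.coe_decompose_mul_add_of_left_mem 𝒜 hx] at this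

lemma sup_span_homogeneous {I : Ideal R} (hI : I.IsHomogeneous 𝒜) {x : R} {n : ℕ} (hx : x ∈ 𝒜 n) :
    (I ⊔ Ideal.span {x}).IsHomogeneous 𝒜 := by
  refine hI.sup (Ideal.homogeneous_span 𝒜 _ ?_)
  rintro y rfl
  exact ⟨n, hx⟩

/-- If `x` is a nonzerodivisor of positive degree on `R/I` and `Ext^{i+1}(R/(I+x),R)=0` then
`Ext^i(R/I,R) = 0`. -/
lemma ex_step [CharZero k] [Nontrivial R] [IsNoetherianRing R]
    (I : Ideal R) (hI : I.IsHomogeneous 𝒜) (i : ℕ) (x : R) (hx : x ∈ irr 𝒜)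
    (hreg : ∀ r, r ∈ I ↔ x * r ∈ I)
    (h : Subsingleton (EX R (R ⧸ (I ⊔ Ideal.span {x})) (i + 1))) :
    Subsingleton (EX R (R ⧸ I) i) := by
  obtain ⟨h1, h2, h3⟩ := colon_ses I I x hreg
  obtain ⟨-, δ, h4, h5⟩ := ex_les _ _ h1 h2 h3 i
  refine ex_nakayama 𝒜 I hI i x hx fun e => ?_
  obtain ⟨e', he'⟩ := (h4 e).1 (Subsingleton.elim _ _)
  refine ⟨e', ?_⟩
  rw [← he', ← exMap_smul_id]
  congr 2

lemma bass_vanishing [CharZero k] [Nontrivial R] [IsNoetherianRing R]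
    (hstd : Algebra.adjoin k (𝒜 1 : Set R) = ⊤) (d : ℕ)
    (hG : ∀ i, i ≠ d → Subsingleton (EX R (R ⧸ irr 𝒜) i)) (I : Ideal R) :
    I.IsHomogeneous 𝒜 → ∀ i, d < i → Subsingleton (EX R (R ⧸ I) i) := by
  refine IsNoetherian.induction (P := fun I : Ideal R => I.IsHomogeneous 𝒜 → ∀ i, d < i →
    Subsingleton (EX R (R ⧸ I) i)) (fun (I : Ideal R) ih hI i hi => ?_) I
  by_cases htop : I = ⊤
  · subst htop
    have : Subsingleton (R ⧸ (⊤ : Ideal R)) := Ideal.Quotient.subsingleton_iff.2 rfl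
    exact ex_of_subsingleton i
  by_cases hm : I = irr 𝒜
  · subst hm; exact hG i hi.ne'
  by_cases hp : I.IsPrime
  · have hle := le_irr 𝒜 hstd hI htop
    obtain ⟨x, hx1, hxI⟩ : ∃ x ∈ 𝒜 1, x ∉ I := by
      by_contra hcon
      push Not at hcon
      apply hm
      apply le_antisymm hle
      rw [irr_eq_span 𝒜 hstd, Ideal.span_le]
      exact hcon
    refine ex_step 𝒜 I hI i x (mem_irr_of_mem 𝒜 one_ne_zero hx1) ?_ ?_
    · intro r
      refine ⟨fun h => I.mul_mem_left _ h, fun h => (hp.mem_or_mem h).resolve_left hxI⟩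
    · refine ih _ ?_ (sup_span_homogeneous 𝒜 hI hx1) _ (by omega)
      refine lt_of_le_of_ne le_sup_left fun h => hxI ?_
      rw [h]; exact Ideal.mem_sup_right (Ideal.mem_span_singleton_self x)
  · obtain ⟨a, b, ⟨na, ha⟩, hab, haI, hbI⟩ : ∃ a b : R, SetLike.IsHomogeneousElem 𝒜 a ∧
        a * b ∈ I ∧ a ∉ I ∧ b ∉ I := by
      by_contra hcon
      push Not at hcon
      apply hp
      refine hI.isPrime_of_homogeneous_mem_or_mem htop fun {x y} hx hy hxy => ?_
      by_cases h : x ∈ I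
      · exact Or.inl h
      · exact Or.inr (hcon x y hx hxy h)
    let J : Ideal R := Submodule.comap (LinearMap.mulLeft R a) I
    have hJ : ∀ r, r ∈ J ↔ a * r ∈ I := fun r => Iff.rfl
    obtain ⟨h1, h2, h3⟩ := colon_ses I J a hJ
    have i1 : Subsingleton (EX R (R ⧸ J) i) := by
      refine ih J ?_ (colon_homogeneous 𝒜 hI ha hJ) i hi
      refine lt_of_le_of_ne (fun r hr => I.mul_mem_left _ hr) fun h => hbI ?_
      rw [h]; exact hab
    have i2 : Subsingleton (EX R (R ⧸ (I ⊔ Ideal.span {a})) i) := by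
      refine ih _ ?_ (sup_span_homogeneous 𝒜 hI ha) i hi
      refine lt_of_le_of_ne le_sup_left fun h => haI ?_
      rw [h]; exact Ideal.mem_sup_right (Ideal.mem_span_singleton_self a)
    exact ex_mid _ _ h1 h2 h3 i

lemma exists_linear_regular [CharZero k] [IsNoetherianRing R]
    (hstd : Algebra.adjoin k (𝒜 1 : Set R) = ⊤) (I : Ideal R)
    (hsat : ∀ r, (∀ x ∈ irr 𝒜, x * r ∈ I) → r ∈ I) :
    ∃ x ∈ 𝒜 1, ∀ r, r ∈ I ↔ x * r ∈ I := by
  classical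
  have hfin := associatedPrimes.finite R (R ⧸ I)
  let s : Finset (Subspace k (𝒜 1)) := hfin.toFinset.image
    (fun P => (P.restrictScalars k).comap (𝒜 1).subtype)
  have hs : ⊤ ∉ s := by
    intro h
    obtain ⟨P, hP, hPt⟩ := Finset.mem_image.1 h
    have hP' : IsAssociatedPrime P (R ⧸ I) := hfin.mem_toFinset.1 hP
    have hle : irr 𝒜 ≤ P := by
      rw [irr_eq_span 𝒜 hstd, Ideal.span_le]
      intro x hx
      have : (⟨x, hx⟩ : 𝒜 1) ∈ (⊤ : Subspace k (𝒜 1)) := trivial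
      rw [← hPt] at this
      exact this
    rw [isAssociatedPrime_iff] at hP'
    obtain ⟨hPp, y, hy⟩ := hP'
    obtain ⟨r, rfl⟩ := Ideal.Quotient.mk_surjective y
    have hr : r ∈ I := hsat r fun x hx => by
      have := hle hx
      rw [hy, Submodule.mem_colon_singleton, Submodule.mem_bot] at this
      exact Ideal.Quotient.eq_zero_iff_mem.1 this
    apply hPp.ne_top
    rw [Ideal.eq_top_iff_one, hy, Submodule.mem_colon_singleton, Submodule.mem_bot, one_smul]
    exact Ideal.Quotient.eq_zero_iff_mem.2 hr
  have := Subspace.biUnion_ne_univ_of_top_notMem hs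
  rw [Set.ne_univ_iff_exists_notMem] at this
  obtain ⟨⟨x, hx1⟩, hx⟩ := this
  refine ⟨x, hx1, fun r => ⟨fun h => I.mul_mem_left _ h, fun h => ?_⟩⟩
  by_contra hr
  have hne : (Ideal.Quotient.mk I r) ≠ 0 := fun h => hr (Ideal.Quotient.eq_zero_iff_mem.1 h)
  obtain ⟨P, hP, hle⟩ := exists_le_isAssociatedPrime_of_isNoetherianRing R
    (Ideal.Quotient.mk I r) hne
  apply hx
  simp only [Set.mem_iUnion]
  refine ⟨_, Finset.mem_image_of_mem _ (hfin.mem_toFinset.2 hP), ?_⟩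
  apply hle
  rw [Submodule.mem_colon_singleton, Submodule.mem_bot]
  exact Ideal.Quotient.eq_zero_iff_mem.2 h

lemma ex_sat_vanishing [CharZero k] [Nontrivial R] [IsNoetherianRing R]
    (hstd : Algebra.adjoin k (𝒜 1 : Set R) = ⊤) (d : ℕ)
    (hG : ∀ i, i ≠ d → Subsingleton (EX R (R ⧸ irr 𝒜) i)) (I : Ideal R)
    (hI : I.IsHomogeneous 𝒜) (hsat : ∀ r, (∀ x ∈ irr 𝒜, x * r ∈ I) → r ∈ I) (i : ℕ) (hi : d ≤ i) :
    Subsingleton (EX R (R ⧸ I) i) := by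
  obtain ⟨x, hx1, hx⟩ := exists_linear_regular 𝒜 hstd I hsat
  exact ex_step 𝒜 I hI i x (mem_irr_of_mem 𝒜 one_ne_zero hx1) hx
    (bass_vanishing 𝒜 hstd d hG _ (sup_span_homogeneous 𝒜 hI hx1) _ (by omega))

end Bass


section Duality

lemma mem_H0 {R M : Type*} [CommRing R] [AddCommGroup M] [Module R M] (J : Ideal R) (x : M) :
    x ∈ H0 (M := M) J ↔ ∃ n : ℕ, ∀ a ∈ J ^ n, a • x = 0 := by
  rw [H0, Submodule.mem_iSup_of_directed]
  · simp only [Submodule.mem_torsionBySet_iff]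
    refine exists_congr fun n => ⟨fun h a ha => h ⟨a, ha⟩, fun h a => h a.1 a.2⟩
  · refine Monotone.directed_le fun a b hab => ?_
    intro x hx
    rw [Submodule.mem_torsionBySet_iff] at hx ⊢
    rintro ⟨r, hr⟩
    exact hx ⟨r, Ideal.pow_le_pow_right hab hr⟩

lemma H0_stab {R M : Type*} [CommRing R] [AddCommGroup M] [Module R M] [IsNoetherian R M]
    (J : Ideal R) : ∃ s : ℕ, ∀ x ∈ H0 (M := M) J, ∀ a ∈ J ^ s, a • x = 0 := by
  obtain ⟨t, ht⟩ := IsNoetherian.noetherian (H0 (M := M) J)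
  have h : ∀ x ∈ t, ∃ n : ℕ, ∀ a ∈ J ^ n, a • x = 0 := fun x hx =>
    (mem_H0 J x).1 (ht ▸ Submodule.subset_span hx)
  choose! n hn using h
  refine ⟨t.sup n, fun x hx a ha => ?_⟩
  rw [← ht] at hx
  induction hx using Submodule.span_induction with
  | mem x hx => exact hn x hx a (Ideal.pow_le_pow_right (Finset.le_sup hx) ha)
  | zero => simp
  | add x y _ _ hx hy => rw [smul_add, hx, hy, add_zero]
  | smul r x _ hx => rw [smul_comm, hx, smul_zero]

lemma finite_length_dual {R : Type} [CommRing R] [IsNoetherianRing R] (m : Ideal R)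
    [hm : m.IsMaximal] (e : ℕ) (hG : ∀ i, i ≠ e + 1 → Subsingleton (EX R (R ⧸ m) i))
    (hGd : Module.length R (EX R (R ⧸ m) (e + 1)) = 1) (s : ℕ)
    (M : Type) [AddCommGroup M] [Module R M] [hM : Module.Finite R M] :
    (∀ a ∈ m ^ s, ∀ x : M, a • x = 0) →
      (∀ i, i ≠ e + 1 → Subsingleton (EX R M i)) ∧
      Module.length R (EX R M (e + 1)) = Module.length R M := by
  refine IsNoetherianRing.induction_on_isQuotientEquivQuotientPrime R hM
    (motive := fun M _ _ _ => (∀ a ∈ m ^ s, ∀ x : M, a • x = 0) →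
      (∀ i, i ≠ e + 1 → Subsingleton (EX R M i)) ∧
      Module.length R (EX R M (e + 1)) = Module.length R M) ?_ ?_ ?_
  · intro N _ _ _ _ _
    refine ⟨fun i _ => ex_of_subsingleton i, ?_⟩
    have := ex_of_subsingleton (R := R) (M := N) (e + 1)
    rw [Module.length_eq_zero, Module.length_eq_zero]
  · intro N _ _ _ p f h
    have hp := p.2
    have hmp : m ^ s ≤ p.1 := by
      intro a ha
      have h1 := h a ha (f.symm (Ideal.Quotient.mk p.1 1))
      rw [← map_smul, LinearEquiv.map_eq_zero_iff] at h1
      have : Ideal.Quotient.mk p.1 (a * 1) = 0 := h1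
      rwa [mul_one, Ideal.Quotient.eq_zero_iff_mem] at this
    have hmp' : m = p.1 := hm.eq_of_le hp.ne_top (hp.le_of_pow_le hmp)
    have f' : (R ⧸ m) ≃ₗ[R] N := (Submodule.quotEquivOfEq _ _ hmp').trans f.symm
    refine ⟨fun i hi => ?_, ?_⟩
    · have := hG i hi
      exact ex_subsingleton_of_equiv i f'
    · rw [← (exEquiv (e + 1) f').length_eq, ← f'.length_eq, hGd]
      have : IsSimpleModule R (R ⧸ m) := by
        rw [isSimpleModule_iff_isCoatom]
        exact hm.out
      rw [Module.length_eq_one]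
  · intro N₁ _ _ _ N₂ _ _ _ N₃ _ _ _ f g hf hg hfg h1 h3 h
    obtain ⟨h1v, h1l⟩ := h1 (fun a ha x => hf (by rw [map_smul, h a ha, map_zero]))
    obtain ⟨h3v, h3l⟩ := h3 (fun a ha x => by
      obtain ⟨y, rfl⟩ := hg x
      rw [← map_smul, h a ha, map_zero])
    refine ⟨fun i hi => ?_, ?_⟩
    · have := h1v i hi
      have := h3v i hi
      exact ex_mid f g hf hg hfg i
    · obtain ⟨-, δ, -, hδ⟩ := ex_les f g hf hg hfg e
      obtain ⟨hex, δ', hδ', -⟩ := ex_les f g hf hg hfg (e + 1)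
      have v1 := h1v e (by omega)
      have v3 := h3v (e + 1 + 1) (by omega)
      have hinj : Function.Injective (exMap (e + 1) g) := by
        rw [injective_iff_map_eq_zero]
        intro x hx
        obtain ⟨y, rfl⟩ := (hδ x).1 hx
        rw [Subsingleton.elim y 0, map_zero]
      have hsurj : Function.Surjective (exMap (e + 1) f) := fun x =>
        (hδ' x).1 (Subsingleton.elim _ _)
      rw [Module.length_eq_add_of_exact _ _ hinj hsurj hex,
        Module.length_eq_add_of_exact _ _ hf hg hfg, h1l, h3l, add_comm]

variable {k R : Type} [Field k] [CommRing R] [Algebra k R]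
    (𝒜 : ℕ → Submodule k R) [GradedAlgebra 𝒜]

/-- saturation -/
noncomputable def satI {R : Type*} [CommRing R] (m Q : Ideal R) : Ideal R :=
  Submodule.comap Q.mkQ (H0 (M := R ⧸ Q) m)

lemma mem_satI {R : Type*} [CommRing R] (m Q : Ideal R) (x : R) :
    x ∈ satI m Q ↔ ∃ n : ℕ, ∀ a ∈ m ^ n, a * x ∈ Q := by
  rw [satI, Submodule.mem_comap, mem_H0]
  refine exists_congr fun n => forall_congr' fun a => forall_congr' fun _ => ?_
  exact Ideal.Quotient.eq_zero_iff_mem (a := a * x)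

lemma le_satI {R : Type*} [CommRing R] (m Q : Ideal R) : Q ≤ satI m Q := fun x hx =>
  (mem_satI m Q x).2 ⟨0, fun a _ => Q.mul_mem_left _ hx⟩

lemma satI_stab {R : Type*} [CommRing R] [IsNoetherianRing R] (m Q : Ideal R) :
    ∃ s : ℕ, ∀ x ∈ satI m Q, ∀ a ∈ m ^ s, a * x ∈ Q := by
  obtain ⟨s, hs⟩ := H0_stab (M := R ⧸ Q) m
  exact ⟨s, fun x hx a ha => Ideal.Quotient.eq_zero_iff_mem.1 (hs _ hx a ha)⟩

lemma satI_sat {R : Type*} [CommRing R] [IsNoetherianRing R] (m Q : Ideal R) (r : R)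
    (h : ∀ x ∈ m, x * r ∈ satI m Q) : r ∈ satI m Q := by
  obtain ⟨s, hs⟩ := satI_stab m Q
  refine (mem_satI m Q r).2 ⟨s + 1, fun a ha => ?_⟩
  rw [pow_succ] at ha
  induction ha using Submodule.mul_induction_on' with
  | mem_mul_mem a ha b hb => rw [mul_assoc]; exact hs _ (h b hb) a ha
  | add x _ y _ hx hy => rw [add_mul]; exact Q.add_mem hx hy

lemma ideal_pow_homogeneous {I : Ideal R} (hI : I.IsHomogeneous 𝒜) (n : ℕ) :
    (I ^ n).IsHomogeneous 𝒜 := by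
  induction n with
  | zero => rw [pow_zero, Ideal.one_eq_top]; exact Ideal.IsHomogeneous.top 𝒜
  | succ n ih => rw [pow_succ]; exact ih.mul hI

lemma satI_homogeneous {Q m : Ideal R} (hQ : Q.IsHomogeneous 𝒜) (hm : m.IsHomogeneous 𝒜) :
    (satI m Q).IsHomogeneous 𝒜 := by
  classical
  intro i r hr
  rw [mem_satI] at hr ⊢
  obtain ⟨n, hn⟩ := hr
  refine ⟨n, fun a ha => ?_⟩
  rw [← DirectSum.sum_support_decompose 𝒜 a, Finset.sum_mul]
  refine Q.sum_mem fun j _ => ?_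
  have h1 := hQ (j + i) (hn _ (ideal_pow_homogeneous 𝒜 hm n j ha))
  rwa [DirectSum.coe_decompose_mul_add_of_left_mem 𝒜 (SetLike.coe_mem _)] at h1

lemma local_duality [CharZero k] [Nontrivial R] [IsNoetherianRing R]
    (hstd : Algebra.adjoin k (𝒜 1 : Set R) = ⊤) (e : ℕ)
    (hG : ∀ i, i ≠ e + 1 → Subsingleton (EX R (R ⧸ irr 𝒜) i))
    (hGd : Module.length R (EX R (R ⧸ irr 𝒜) (e + 1)) = 1)
    (Q : Ideal R) (hQ : Q.IsHomogeneous 𝒜) :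
    kLength k (extModule R (e + 1) (ModuleCat.of R (R ⧸ Q)) (ModuleCat.of R R)) =
      Module.finrank k (H0 (M := R ⧸ Q) (irr 𝒜)) := by
  have hmax := irr_maximal 𝒜 hstd
  obtain ⟨s, hs⟩ := H0_stab (M := R ⧸ Q) (irr 𝒜)
  let Γ := H0 (M := R ⧸ Q) (irr 𝒜)
  have hΓ : ∀ a ∈ (irr 𝒜) ^ s, ∀ x : Γ, a • x = 0 := fun a ha x =>
    Subtype.ext (hs x.1 x.2 a ha)
  obtain ⟨hv, hl⟩ := finite_length_dual (irr 𝒜) e hG hGd s Γ hΓ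
  let Q' := satI (irr 𝒜) Q
  have hQ' : Q'.IsHomogeneous 𝒜 :=
    satI_homogeneous 𝒜 hQ (HomogeneousIdeal.isHomogeneous _)
  have hvan := ex_sat_vanishing 𝒜 hstd (e + 1) hG Q' hQ' (satI_sat _ _)
  let g := Submodule.factor (le_satI (irr 𝒜) Q)
  have hfg : Function.Exact Γ.subtype g := by
    intro x
    obtain ⟨r, rfl⟩ := Ideal.Quotient.mk_surjective x
    have h1 : g (Ideal.Quotient.mk Q r) = 0 ↔ r ∈ Q' :=
      Ideal.Quotient.eq_zero_iff_mem (I := Q')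
    rw [h1]
    constructor
    · intro h; exact ⟨⟨_, h⟩, rfl⟩
    · rintro ⟨y, hy⟩
      have := y.2
      change (Γ.subtype y) ∈ Γ at this
      rw [hy] at this
      exact this
  obtain ⟨hex, δ, hδ, -⟩ := ex_les Γ.subtype g Γ.injective_subtype (Submodule.factor_surjective _)
    hfg (e + 1)
  have v1 := hvan (e + 1) le_rfl
  have v2 := hvan (e + 1 + 1) (by omega)
  have hinj : Function.Injective (exMap (e + 1) Γ.subtype) := by
    rw [injective_iff_map_eq_zero]
    intro x hx
    obtain ⟨y, rfl⟩ := (hex x).1 hx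
    rw [Subsingleton.elim y 0, map_zero]
  have hsurj : Function.Surjective (exMap (e + 1) Γ.subtype) := fun x =>
    (hδ x).1 (Subsingleton.elim _ _)
  obtain ⟨E1⟩ := extModule_equiv e (ModuleCat.of R (R ⧸ Q)) (ModuleCat.of R R)
  let E2 : extModule R (e + 1) (ModuleCat.of R (R ⧸ Q)) (ModuleCat.of R R) ≃ₗ[R] EX R Γ (e + 1) :=
    E1.trans (LinearEquiv.ofBijective _ ⟨hinj, hsurj⟩)
  rw [kLength_eq (irr 𝒜) (irr_surj 𝒜 hstd) s, E2.length_eq, hl, finrank_eq_toNat_length,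
    length_bridge (irr 𝒜) (irr_surj 𝒜 hstd) s Γ hΓ]
  intro a ha x
  apply E2.injective
  rw [map_smul, map_zero, ← exMap_smul_id]
  have : a • (LinearMap.id : Γ →ₗ[R] Γ) = (0 : R) • LinearMap.id := by
    ext1 y
    rw [LinearMap.smul_apply, LinearMap.smul_apply, LinearMap.id_apply, hΓ a ha, zero_smul]
  rw [this, exMap_smul_id, zero_smul]

end Duality


section PartA
open CategoryTheory
variable {k R : Type} [Field k] [CommRing R] [Algebra k R]
    (𝒜 : ℕ → Submodule k R) [GradedAlgebra 𝒜]

lemma ex_killed {R : Type} [CommRing R] (m : Ideal R) (i : ℕ) (a : R) (ha : a ∈ m)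
    (x : EX R (R ⧸ m) i) : a • x = 0 := by
  rw [← exMap_smul_id]
  have : a • (LinearMap.id : (R ⧸ m) →ₗ[R] (R ⧸ m)) = (0 : R) • LinearMap.id := by
    ext
    simp only [zero_smul]
    change Ideal.Quotient.mk m (a * 1) = 0
    rw [Ideal.Quotient.eq_zero_iff_mem]; simpa using ha
  rw [this, exMap_smul_id, zero_smul]

lemma irr_ne_bot [Nontrivial R]
    (hdepth : ∃ a b : R, a ∈ irr 𝒜 ∧ b ∈ irr 𝒜 ∧ RingTheory.Sequence.IsRegular R [a, b]) :
    irr 𝒜 ≠ ⊥ := by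
  intro h
  obtain ⟨a, b, ha, hb, hreg⟩ := hdepth
  rw [h, Ideal.mem_bot] at ha hb
  subst ha hb
  have h1 := hreg.regular_mod_prev 0 (by simp)
  have hz : ∀ x : R ⧸ (Ideal.ofList ([(0 : R), 0].take 0) • ⊤ : Submodule R R), x = 0 := by
    intro x
    apply h1
    change (0 : R) • x = (0 : R) • _
    rw [zero_smul, zero_smul]
  have h2 := hz (Submodule.Quotient.mk 1)
  rw [Submodule.Quotient.mk_eq_zero] at h2
  simp at h2

theorem partA [CharZero k] [IsDomain R] (hFG : Algebra.FiniteType k R)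
    (hstd : Algebra.adjoin k (𝒜 1 : Set R) = ⊤)
    (d : ℕ) (hd : ringKrullDim R = d)
    (hdepth : ∃ a b : R, a ∈ irr 𝒜 ∧ b ∈ irr 𝒜 ∧ RingTheory.Sequence.IsRegular R [a, b])
    (hGor : ∀ i : ℕ,
      kLength k (extModule R i (ModuleCat.of R (R ⧸ irr 𝒜)) (ModuleCat.of R R)) =
        if i = d then 1 else 0)
    (Q : Ideal R) (hQ : Q.IsHomogeneous 𝒜) :
    kLength k (extModule R d (ModuleCat.of R (R ⧸ Q)) (ModuleCat.of R R)) =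
      Module.finrank k (H0 (M := R ⧸ Q) (irr 𝒜)) := by
  have hN : IsNoetherianRing R := Algebra.FiniteType.isNoetherianRing k R
  have hbot := irr_ne_bot 𝒜 hdepth
  have hmax := irr_maximal 𝒜 hstd
  obtain ⟨e, rfl⟩ : ∃ e, d = e + 1 := by
    refine Nat.exists_eq_succ_of_ne_zero ?_
    rintro rfl
    have : Ring.KrullDimLE 0 R := Ring.krullDimLE_iff.2 (by rw [hd])
    have hf : IsField R := Ring.KrullDimLE.isField_of_isDomain
    let _ := hf.toField
    exact hbot ((Ideal.eq_bot_or_top (irr 𝒜)).resolve_right hmax.ne_top)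
  have key : ∀ i, (Module.length R (EX R (R ⧸ irr 𝒜) (i + 1))).toNat = if i = e then 1 else 0 := by
    intro i
    have h := hGor (i + 1)
    obtain ⟨E⟩ := extModule_equiv i (ModuleCat.of R (R ⧸ irr 𝒜)) (ModuleCat.of R R)
    rw [kLength_eq (irr 𝒜) (irr_surj 𝒜 hstd) 1, E.length_eq] at h
    · simpa using h
    · intro a ha x
      apply E.injective
      rw [map_smul, map_zero]
      exact ex_killed _ _ a (by simpa using ha) _
  have hfin : ∀ i, Module.length R (EX R (R ⧸ irr 𝒜) i) ≠ ⊤ := by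
    intro i
    let _ : Field (R ⧸ irr 𝒜) := Ideal.Quotient.field _
    have htor : Module.IsTorsionBySet R (EX R (R ⧸ irr 𝒜) i) (irr 𝒜) := fun x a =>
      ex_killed _ _ a.1 a.2 x
    let _ : Module (R ⧸ irr 𝒜) (EX R (R ⧸ irr 𝒜) i) := htor.module
    have : IsScalarTower R (R ⧸ irr 𝒜) (EX R (R ⧸ irr 𝒜) i) := htor.isScalarTower
    have : Module.Finite (R ⧸ irr 𝒜) (EX R (R ⧸ irr 𝒜) i) :=
      Module.Finite.of_restrictScalars_finite R _ _
    rw [Module.length_eq_of_surjective (R := R ⧸ irr 𝒜) (S := R) Ideal.Quotient.mk_surjective]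
    exact Module.length_ne_top
  refine local_duality 𝒜 hstd e ?_ ?_ Q hQ
  · intro i hi
    rcases i with _ | i
    · refine (CategoryTheory.Abelian.Ext.addEquiv₀ (X := ModuleCat.of R (R ⧸ irr 𝒜))
        (Y := ModuleCat.of R R)).toEquiv.subsingleton_congr.2 ⟨fun f g => ?_⟩
      obtain ⟨a, ha, ha0⟩ := Submodule.exists_mem_ne_zero_of_ne_bot hbot
      have h0 : ∀ f : (ModuleCat.of R (R ⧸ irr 𝒜) ⟶ ModuleCat.of R R), f = 0 := by
        intro f
        refine ModuleCat.hom_ext (LinearMap.ext fun x => ?_)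
        have h1 : a • f.hom x = 0 := by
          rw [← map_smul]
          obtain ⟨r, rfl⟩ := Ideal.Quotient.mk_surjective x
          have : a • (Ideal.Quotient.mk (irr 𝒜) r) = 0 :=
            Ideal.Quotient.eq_zero_iff_mem.2 (Ideal.mul_mem_right r _ ha)
          exact (congrArg f.hom this).trans (map_zero _)
        exact (mul_eq_zero.1 h1).resolve_left ha0
      rw [h0 f, h0 g]
    · have := key i
      rw [if_neg (by omega)] at this
      rcases (ENat.toNat_eq_zero).1 this with h | h
      · exact Module.length_eq_zero_iff.1 h
      · exact absurd h (hfin _)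
  · have := key e
    rw [if_pos rfl] at this
    rw [← ENat.natCast_toNat (hfin (e + 1)), this]; rfl

end PartA


section DegreeBound
open Polynomial

lemma rees_coeff {R : Type*} [CommRing R] (I J : Ideal R) (z : reesAlgebra I)
    (hz : z ∈ J.map (algebraMap R (reesAlgebra I))) :
    ∀ n : ℕ, (z : R[X]).coeff n ∈ J * I ^ n := by
  unfold Ideal.map at hz
  refine Submodule.span_induction (p := fun (z : reesAlgebra I) _ => ∀ n : ℕ, (z : R[X]).coeff n ∈ J * I ^ n)
    ?_ ?_ ?_ ?_ hz
  · rintro x ⟨a, ha, rfl⟩ n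
    change (C a).coeff n ∈ _
    rw [coeff_C]
    split_ifs with h
    · subst h; simpa using ha
    · exact zero_mem _
  · intro n; simp
  · intro x y _ _ hx hy n
    simp only [Subalgebra.coe_add, coeff_add]
    exact Ideal.add_mem _ (hx n) (hy n)
  · intro w x _ hx n
    simp only [smul_eq_mul, Subalgebra.coe_mul, coeff_mul]
    refine Ideal.sum_mem _ fun p hp => ?_
    rw [← (Finset.HasAntidiagonal.mem_antidiagonal.1 hp), pow_add, ← mul_assoc, mul_comm J, mul_assoc]
    exact Ideal.mul_mem_mul (w.2 _) (hx _)

lemma rees_monomial_mem {R : Type*} [CommRing R] (I J : Ideal R) (n : ℕ) (u : R)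
    (hu : u ∈ J * I ^ n) (hu' : u ∈ I ^ n) :
    (⟨monomial n u, reesAlgebra.monomial_mem.2 hu'⟩ : reesAlgebra I) ∈
      J.map (algebraMap R (reesAlgebra I)) := by
  suffices h : ∃ h' : monomial n u ∈ reesAlgebra I, (⟨monomial n u, h'⟩ : reesAlgebra I) ∈
      J.map (algebraMap R (reesAlgebra I)) from h.2
  clear hu'
  induction hu using Submodule.mul_induction_on' with
  | mem_mul_mem a ha b hb =>
    refine ⟨reesAlgebra.monomial_mem.2 (Ideal.mul_mem_left _ _ hb), ?_⟩
    have h1 : (⟨monomial n b, reesAlgebra.monomial_mem.2 hb⟩ : reesAlgebra I) *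
        algebraMap R (reesAlgebra I) a ∈ J.map (algebraMap R (reesAlgebra I)) :=
      Ideal.mul_mem_left _ _ (Ideal.mem_map_of_mem _ ha)
    convert h1 using 1
    apply Subtype.ext
    change monomial n (a * b) = monomial n b * C a
    rw [monomial_mul_C, mul_comm]
  | add x _ y _ hx hy =>
    obtain ⟨h1, h2⟩ := hx
    obtain ⟨h3, h4⟩ := hy
    refine ⟨by rw [map_add]; exact add_mem h1 h3, ?_⟩
    have h5 := Ideal.add_mem _ h2 h4
    convert h5 using 1
    apply Subtype.ext
    change monomial n (x + y) = monomial n x + monomial n y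
    rw [map_add]

lemma sat_artin_rees {S : Type*} [CommRing S] [IsNoetherianRing S] (I m : Ideal S) :
    ∃ s : ℕ, ∀ z ∈ m ^ s, z ∈ satI m I → z ∈ I := by
  obtain ⟨N, hN⟩ := satI_stab m I
  obtain ⟨k, hk⟩ := m.exists_pow_inf_eq_pow_smul (satI m I)
  refine ⟨k + N, fun z hz1 hz2 => ?_⟩
  have hz3 : z ∈ m ^ (k + N) • (⊤ : Ideal S) ⊓ satI m I := by
    refine ⟨?_, hz2⟩
    rw [smul_eq_mul, Ideal.mul_top]; exact hz1
  rw [hk (k + N) (by omega), Nat.add_sub_cancel_left] at hz3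
  have hle : m ^ N • (m ^ k • (⊤ : Ideal S) ⊓ satI m I) ≤ I := by
    rw [smul_eq_mul, Ideal.mul_le]
    intro r hr x hx
    exact hN x hx.2 r hr
  exact hle hz3

lemma rees_sat {R : Type*} [CommRing R] (I m : Ideal R) (n : ℕ) (u : R) (hu' : u ∈ I ^ n)
    (hsat : u ∈ satI m (I ^ (n + 1))) :
    (⟨monomial n u, reesAlgebra.monomial_mem.2 hu'⟩ : reesAlgebra I) ∈
      satI (m.map (algebraMap R (reesAlgebra I))) (I.map (algebraMap R (reesAlgebra I))) := by
  rw [mem_satI] at hsat ⊢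
  obtain ⟨j, hj⟩ := hsat
  refine ⟨j, fun a ha => ?_⟩
  rw [← Ideal.map_pow] at ha
  refine Submodule.span_induction (p := fun (a : reesAlgebra I) _ =>
    a * (⟨monomial n u, reesAlgebra.monomial_mem.2 hu'⟩ : reesAlgebra I) ∈
      I.map (algebraMap R (reesAlgebra I))) ?_ ?_ ?_ ?_ ha
  · rintro x ⟨b, hb, rfl⟩
    have h1 := hj b hb
    have h2 := rees_monomial_mem I I n (b * u) (by rwa [pow_succ'] at h1)
      (Ideal.mul_mem_left _ _ hu')
    convert h2 using 1
    apply Subtype.ext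
    change C b * monomial n u = monomial n (b * u)
    rw [C_mul_monomial]
  · rw [zero_mul]; exact zero_mem _
  · intro x y _ _ hx hy; rw [add_mul]; exact Ideal.add_mem _ hx hy
  · intro w x _ hx; rw [smul_eq_mul, mul_assoc]; exact Ideal.mul_mem_left _ _ hx

lemma rees_bound {R : Type*} [CommRing R] [IsNoetherianRing R] (I m : Ideal R) :
    ∃ s : ℕ, ∀ n : ℕ, ∀ u : R, u ∈ m ^ s * I ^ n → u ∈ satI m (I ^ (n + 1)) → u ∈ I ^ (n + 1) := by
  obtain ⟨s, hs⟩ := sat_artin_rees (I.map (algebraMap R (reesAlgebra I)))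
    (m.map (algebraMap R (reesAlgebra I)))
  refine ⟨s, fun n u hu hsat => ?_⟩
  have hle : m ^ s * I ^ n ≤ I ^ n := Ideal.mul_le_right
  have hu' : u ∈ I ^ n := hle hu
  have hz1 : (⟨monomial n u, reesAlgebra.monomial_mem.2 hu'⟩ : reesAlgebra I) ∈
      (m.map (algebraMap R (reesAlgebra I))) ^ s := by
    rw [← Ideal.map_pow]; exact rees_monomial_mem I _ n u hu hu'
  have h2 := hs _ hz1 (rees_sat I m n u hu' hsat)
  have h3 := rees_coeff I I _ h2 n
  rw [← pow_succ'] at h3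
  change (monomial n u).coeff n ∈ _ at h3
  rwa [coeff_monomial_same] at h3

variable {k R : Type} [Field k] [CommRing R] [Algebra k R]
    (𝒜 : ℕ → Submodule k R) [GradedAlgebra 𝒜]

lemma exists_gens [IsNoetherianRing R] {I : Ideal R} (hI : I.IsHomogeneous 𝒜) :
    ∃ e : ℕ, I = Ideal.span {x : R | x ∈ I ∧ ∃ i ≤ e, x ∈ 𝒜 i} := by
  classical
  obtain ⟨t, ht⟩ := IsNoetherian.noetherian I
  refine ⟨t.sup fun x => (DirectSum.decompose 𝒜 x).support.sup id, ?_⟩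
  apply le_antisymm
  · conv_lhs => rw [← ht]
    refine Submodule.span_le.2 fun x hx => ?_
    rw [← DirectSum.sum_support_decompose 𝒜 x]
    refine Ideal.sum_mem _ fun i hi => Ideal.subset_span ⟨?_, i, ?_, SetLike.coe_mem _⟩
    · exact hI i (ht ▸ Submodule.subset_span hx)
    · exact (Finset.le_sup (f := id) hi).trans
        (Finset.le_sup (f := fun x => (DirectSum.decompose 𝒜 x).support.sup id) hx)
  · exact Ideal.span_le.2 fun x hx => hx.1

lemma high_degree_mem (hstd : Algebra.adjoin k (𝒜 1 : Set R) = ⊤)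
    {I : Ideal R} (e : ℕ) (he : I = Ideal.span {x : R | x ∈ I ∧ ∃ i ≤ e, x ∈ 𝒜 i}) (s n : ℕ) :
    ∀ u ∈ I ^ n, ∀ a, e * n + s ≤ a → (DirectSum.decompose 𝒜 u a : R) ∈ irr 𝒜 ^ s * I ^ n := by
  induction n with
  | zero =>
    intro u _ a ha
    rw [pow_zero, mul_one]
    exact Ideal.pow_le_pow_right (by omega) (mem_irr_pow 𝒜 hstd (SetLike.coe_mem _))
  | succ n ih =>
    intro u hu a ha
    rw [pow_succ'] at hu
    induction hu using Submodule.mul_induction_on' with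
    | mem_mul_mem v hv w hw =>
      rw [he] at hv
      induction hv using Submodule.span_induction generalizing w with
      | mem x hx =>
        obtain ⟨hxI, i, hi, hxi⟩ := hx
        have hai : i ≤ a := by nlinarith
        rw [DirectSum.coe_decompose_mul_of_left_mem_of_le 𝒜 hxi hai, pow_succ', mul_left_comm]
        refine Ideal.mul_mem_mul hxI (ih w hw _ ?_)
        have : e * (n + 1) = e * n + e := by ring
        omega
      | zero => simp
      | add x y _ _ hx hy =>
        rw [add_mul, DirectSum.decompose_add]
        exact Ideal.add_mem _ (hx w hw) (hy w hw)
      | smul r x _ hx =>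
        have := hx (r * w) (Ideal.mul_mem_left _ _ hw)
        have e1 : r • x * w = x * (r * w) := by rw [smul_eq_mul]; ring
        rwa [e1]
    | add x _ y _ hx hy =>
      rw [DirectSum.decompose_add]
      exact Ideal.add_mem _ hx hy

theorem degree_bound [IsNoetherianRing R] (hstd : Algebra.adjoin k (𝒜 1 : Set R) = ⊤)
    {I : Ideal R} (hI : I.IsHomogeneous 𝒜) :
    ∃ c₀ : ℕ, ∀ n, 1 ≤ n → ∀ a, c₀ * n ≤ a → ∀ u ∈ 𝒜 a, u ∈ satI (irr 𝒜) (I ^ n) → u ∈ I ^ n := by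
  obtain ⟨e, he⟩ := exists_gens 𝒜 hI
  obtain ⟨s, hs⟩ := rees_bound I (irr 𝒜)
  have key : ∀ n, ∀ a, e * n + s ≤ a → ∀ u ∈ 𝒜 a, u ∈ satI (irr 𝒜) (I ^ n) → u ∈ I ^ n := by
    intro n
    induction n with
    | zero => intro a _ u _ _; simp
    | succ n ih =>
      intro a ha u hua hsat
      refine hs n u ?_ hsat
      have hu : u ∈ I ^ n := by
        refine ih a (by nlinarith) u hua ?_
        rw [mem_satI] at hsat ⊢
        obtain ⟨j, hj⟩ := hsat
        exact ⟨j, fun b hb => Ideal.pow_le_pow_right (Nat.le_succ n) (hj b hb)⟩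
      have := high_degree_mem 𝒜 hstd e he s n u hu a (by nlinarith)
      rwa [DirectSum.decompose_of_mem_same 𝒜 hua] at this
  refine ⟨e + s, fun n hn a ha => key n a ?_⟩
  nlinarith

end DegreeBound


lemma val_sum_distinct {R Γ ι : Type*} [Ring R] [LinearOrderedCommGroupWithZero Γ]
    (v : Valuation R Γ) (s : Finset ι) (hs : s.Nonempty) (f : ι → R)
    (hd : ∀ i ∈ s, ∀ j ∈ s, v (f i) = v (f j) → i = j) :
    ∃ i ∈ s, v (∑ i ∈ s, f i) = v (f i) := by
  obtain ⟨j, hj, hmax⟩ := s.exists_max_image (fun i => v (f i)) hs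
  classical
  by_cases h0 : v (f j) = 0
  · refine ⟨j, hj, ?_⟩
    have : s = {j} := by
      ext i
      simp only [Finset.mem_singleton]
      constructor
      · intro hi
        refine hd i hi j hj ?_
        have := hmax i hi
        rw [h0] at this ⊢
        simpa using this
      · rintro rfl; exact hj
    rw [this]; simp
  · refine ⟨j, hj, Valuation.map_sum_eq_of_lt v hj ?_⟩
    intro i hi
    rw [Finset.mem_sdiff, Finset.mem_singleton] at hi
    exact lt_of_le_of_ne (hmax i hi.1) fun h => hi.2 (hd i hi.1 j hj h)

section
variable {k K : Type} [Field k] [Field K] [Algebra k K] {d : ℕ}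
  (φ : MvPolynomial (Fin d) k →ₐ[k] K)

open MonomialOrder

/-- fractions `a/b` with `deg a ≤ deg b` for the lex order -/
noncomputable def fracRing : Subring K where
  carrier := {x | ∃ a b : MvPolynomial (Fin d) k, b ≠ 0 ∧
    lex.toSyn (lex.degree a) ≤ lex.toSyn (lex.degree b) ∧ x * φ b = φ a}
  mul_mem' := by
    rintro x y ⟨a, b, hb, hab, h⟩ ⟨a', b', hb', hab', h'⟩
    refine ⟨a * a', b * b', mul_ne_zero hb hb', ?_, ?_⟩
    · refine (degree_mul_le (m := lex)).trans ?_
      rw [degree_mul hb hb', map_add, map_add]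
      exact add_le_add hab hab'
    · rw [map_mul, map_mul, ← h, ← h']; ring
  one_mem' := ⟨1, 1, one_ne_zero, le_rfl, by simp⟩
  add_mem' := by
    rintro x y ⟨a, b, hb, hab, h⟩ ⟨a', b', hb', hab', h'⟩
    refine ⟨a * b' + a' * b, b * b', mul_ne_zero hb hb', ?_, ?_⟩
    · refine (degree_add_le (m := lex)).trans ?_
      rw [degree_mul hb hb', map_add]
      refine max_le ((degree_mul_le (m := lex)).trans ?_) ((degree_mul_le (m := lex)).trans ?_)
      · rw [map_add]; exact add_le_add hab le_rfl
      · rw [map_add, add_comm]; exact add_le_add le_rfl hab'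
    · simp only [map_mul, map_add, ← h, ← h']; ring
  zero_mem' := ⟨0, 1, one_ne_zero, by simp, by simp⟩
  neg_mem' := by
    rintro x ⟨a, b, hb, hab, h⟩
    exact ⟨-a, b, hb, by rwa [degree_neg], by rw [map_neg, ← h]; ring⟩

/-- fractions `a/b` with `deg a < deg b` for the lex order -/
noncomputable def fracIdeal : Ideal (fracRing φ) where
  carrier := {x | ∃ a b : MvPolynomial (Fin d) k, b ≠ 0 ∧
    (a = 0 ∨ lex.toSyn (lex.degree a) < lex.toSyn (lex.degree b)) ∧ (x : K) * φ b = φ a}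
  zero_mem' := ⟨0, 1, one_ne_zero, by simp, by simp⟩
  add_mem' := by
    rintro x y ⟨a, b, hb, hab, h⟩ ⟨a', b', hb', hab', h'⟩
    refine ⟨a * b' + a' * b, b * b', mul_ne_zero hb hb', ?_, ?_⟩
    · rcases hab with rfl | hab
      · rcases hab' with rfl | hab'
        · simp
        · right
          rw [zero_mul, zero_add]
          refine (degree_mul_le (m := lex)).trans_lt ?_
          rw [degree_mul hb hb', map_add, map_add, add_comm]
          exact (add_lt_add_iff_left _).2 hab'
      · rcases hab' with rfl | hab'
        · right
          rw [zero_mul, add_zero]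
          refine (degree_mul_le (m := lex)).trans_lt ?_
          rw [degree_mul hb hb', map_add, map_add]
          exact (add_lt_add_iff_right _).2 hab
        · right
          refine (degree_add_le (m := lex)).trans_lt ?_
          rw [degree_mul hb hb', map_add]
          refine max_lt ((degree_mul_le (m := lex)).trans_lt ?_)
            ((degree_mul_le (m := lex)).trans_lt ?_)
          · rw [map_add]; exact (add_lt_add_iff_right _).2 hab
          · rw [map_add, add_comm]; exact (add_lt_add_iff_left _).2 hab'
    · simp only [map_mul, map_add, ← h, ← h', Subring.coe_add]; ring
  smul_mem' := by
    rintro ⟨x, a', b', hb', hab', h'⟩ y ⟨a, b, hb, hab, h⟩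
    refine ⟨a' * a, b' * b, mul_ne_zero hb' hb, ?_, ?_⟩
    · rcases hab with rfl | hab
      · simp
      · right
        refine (degree_mul_le (m := lex)).trans_lt ?_
        rw [degree_mul hb' hb, map_add, map_add]
        exact add_lt_add_of_le_of_lt hab' hab
    · simp only [map_mul, ← h, ← h', smul_eq_mul, Subring.coe_mul]; ring

lemma fracIdeal_ne_top (hφ : Function.Injective φ) : fracIdeal φ ≠ ⊤ := by
  rw [Ideal.ne_top_iff_one]
  rintro ⟨a, b, hb, hab, h⟩
  rw [Subring.coe_one, one_mul] at h
  have := hφ h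
  subst this
  rcases hab with h | h
  · exact hb h
  · exact lt_irrefl _ h

lemma exists_val_field (hφ : Function.Injective φ) : ∃ (Γ : Type) (_ : LinearOrderedCommGroupWithZero Γ) (v : Valuation K Γ),
    ∀ a b : MvPolynomial (Fin d) k, a ≠ 0 → b ≠ 0 →
      (v (φ a) = v (φ b) ↔ lex.degree a = lex.degree b) := by
  obtain ⟨O, h1, h2⟩ := Ideal.image_subset_nonunits_valuationSubring _ (fracIdeal_ne_top φ hφ)
  refine ⟨_, _, O.valuation, ?_⟩
  have hne : ∀ a, a ≠ 0 → φ a ≠ 0 := fun a ha h => ha (hφ (by rw [h, map_zero]))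
  have hle : ∀ a b : MvPolynomial (Fin d) k, b ≠ 0 →
      lex.toSyn (lex.degree a) ≤ lex.toSyn (lex.degree b) →
      O.valuation (φ a) ≤ O.valuation (φ b) := by
    intro a b hb hab
    have : φ a / φ b ∈ O := h1 ⟨a, b, hb, hab, div_mul_cancel₀ _ (hne b hb)⟩
    rw [← O.valuation_le_one_iff, map_div₀] at this
    rwa [div_le_one₀ (zero_lt_iff.2 ((Valuation.ne_zero_iff _).2 (hne b hb)))] at this
  have hlt : ∀ a b : MvPolynomial (Fin d) k, b ≠ 0 →
      lex.toSyn (lex.degree a) < lex.toSyn (lex.degree b) →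
      O.valuation (φ a) < O.valuation (φ b) := by
    intro a b hb hab
    have hm : φ a / φ b ∈ fracRing φ := ⟨a, b, hb, hab.le, div_mul_cancel₀ _ (hne b hb)⟩
    have : φ a / φ b ∈ O.nonunits := h2 ⟨⟨_, hm⟩, ⟨a, b, hb, Or.inr hab,
      div_mul_cancel₀ _ (hne b hb)⟩, rfl⟩
    rw [ValuationSubring.mem_nonunits_iff, map_div₀] at this
    rwa [div_lt_one₀ (zero_lt_iff.2 ((Valuation.ne_zero_iff _).2 (hne b hb)))] at this
  intro a b ha hb
  constructor
  · intro h
    rcases lt_trichotomy (lex.toSyn (lex.degree a)) (lex.toSyn (lex.degree b)) with h' | h' | h'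
    · exact absurd h (hlt a b hb h').ne
    · exact lex.toSyn.injective h'
    · exact absurd h (hlt b a ha h').ne'
  · intro h
    exact le_antisymm (hle a b hb (by rw [h])) (hle b a ha (by rw [h]))

end

open MonomialOrder in
/-- the valuation package -/
theorem exists_val {k R : Type} [Field k] [CommRing R] [IsDomain R] [Algebra k R] {d : ℕ}
    (φ : MvPolynomial (Fin d) k →ₐ[k] R) (hφ : Function.Injective φ)
    (hphi_int : φ.toRingHom.IsIntegral) :
    ∃ (Γ : Type) (_ : LinearOrderedCommGroupWithZero Γ) (v : Valuation R Γ),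
      (∀ x, v x = 0 → x = 0) ∧ (∀ c : k, c ≠ 0 → v (algebraMap k R c) = 1) ∧
      (∀ α β : Fin d →₀ ℕ, v (φ (MvPolynomial.monomial α 1)) = v (φ (MvPolynomial.monomial β 1)) →
        α = β) ∧
      (∀ x, x ≠ 0 → ∃ e, 0 < e ∧ ∃ α β : Fin d →₀ ℕ,
        v x ^ e * v (φ (MvPolynomial.monomial α 1)) = v (φ (MvPolynomial.monomial β 1))) := by
  let K := FractionRing R
  have hinj := IsFractionRing.injective R K
  let ψ : MvPolynomial (Fin d) k →ₐ[k] K := (IsScalarTower.toAlgHom k R K).comp φ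
  have hψ : Function.Injective ψ := hinj.comp hφ
  obtain ⟨Γ, _, v, hv⟩ := exists_val_field ψ hψ
  have hdeg : ∀ α : Fin d →₀ ℕ, lex.degree (MvPolynomial.monomial α (1:k)) = α := by
    intro α; classical rw [MonomialOrder.degree_monomial, if_neg one_ne_zero]
  have hv0 : ∀ x, (v.comap (algebraMap R K)) x = 0 → x = 0 := by
    intro x hx
    rw [Valuation.comap_apply, Valuation.zero_iff] at hx
    exact hinj (by rw [hx, map_zero])
  have hmon : ∀ a : MvPolynomial (Fin d) k, a ≠ 0 → (v.comap (algebraMap R K)) (φ a) =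
      (v.comap (algebraMap R K)) (φ (MvPolynomial.monomial (lex.degree a) 1)) := by
    intro a ha
    exact (hv a (MvPolynomial.monomial (lex.degree a) 1) ha (by simp)).2 (by rw [hdeg])
  refine ⟨Γ, _, v.comap (algebraMap R K), hv0, ?_, ?_, ?_⟩
  · intro c hc
    have := (hv (MvPolynomial.C c) 1 (by simpa using hc) one_ne_zero).2 (by simp)
    rw [map_one, map_one] at this
    rw [Valuation.comap_apply, ← this]
    congr 1
    change _ = algebraMap R K (φ (algebraMap k _ c))
    rw [AlgHom.commutes]
  · intro α β h
    have := (hv (MvPolynomial.monomial α 1) (MvPolynomial.monomial β 1) (by simp) (by simp)).1 h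
    rwa [hdeg, hdeg] at this
  · intro x hx
    set w := v.comap (algebraMap R K)
    have hw : ∀ x, x ≠ 0 → w x ≠ 0 := fun x hx h => hx (hv0 x h)
    have hφ0 : ∀ a, a ≠ 0 → φ a ≠ 0 := fun a ha h => ha (hφ (by rw [h, map_zero]))
    obtain ⟨p, hp, hpx⟩ := hphi_int x
    rw [Polynomial.eval₂_eq_sum_range'  _ (Nat.lt_succ_self _)] at hpx
    by_contra! hcon
    have hsum : ∑ i ∈ p.support, φ (p.coeff i) * x ^ i = 0 := by
      rw [← hpx]
      refine Finset.sum_subset ?_ ?_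
      · intro i hi
        exact Finset.mem_range_succ_iff.2 (Polynomial.le_natDegree_of_mem_supp _ hi)
      · intro i _ hi
        rw [Polynomial.notMem_support_iff.1 hi]; simp
    have key : ∀ i ∈ p.support, ∀ j ∈ p.support, i < j →
        w (φ (p.coeff i) * x ^ i) ≠ w (φ (p.coeff j) * x ^ j) := by
      intro i hi j hj hij h
      rw [Polynomial.mem_support_iff] at hi hj
      refine hcon (j - i) (by omega) (lex.degree (p.coeff j)) (lex.degree (p.coeff i)) ?_
      rw [map_mul, map_mul, map_pow, map_pow, hmon _ hi, hmon _ hj] at h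
      have hj' : w x ^ j = w x ^ (j - i) * w x ^ i := by rw [← pow_add]; congr 1; omega
      rw [hj', ← mul_assoc] at h
      have := mul_right_cancel₀ (pow_ne_zero i (hw x hx)) h
      rw [mul_comm]
      simpa using this.symm
    obtain ⟨i, hi, h⟩ := val_sum_distinct w p.support
      (by rw [Polynomial.support_nonempty]; exact hp.ne_zero) (fun i => φ (p.coeff i) * x ^ i) (by
        intro i hi j hj h
        rcases lt_trichotomy i j with h' | h' | h'
        · exact absurd h (key i hi j hj h')
        · exact h'
        · exact absurd h.symm (key j hj i hi h'))
    rw [hsum, map_zero] at h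
    exact hw _ (mul_ne_zero (hφ0 _ (Polynomial.mem_support_iff.1 hi)) (pow_ne_zero i hx)) h.symm


lemma dim_eq_of_integral {A S : Type} [CommRing A] [CommRing S] [IsDomain S] [Algebra A S]
    [Algebra.IsIntegral A S] (hinj : Function.Injective (algebraMap A S)) :
    ringKrullDim S = ringKrullDim A := by
  apply le_antisymm
  · refine Order.krullDim_le_of_strictMono (PrimeSpectrum.comap (algebraMap A S)) ?_
    intro p q hpq
    exact Ideal.IsIntegral.comap_lt_comap (R := A) (I := p.asIdeal) (J := q.asIdeal) hpq
  · refine iSup_le fun l => ?_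
    have : FaithfulSMul A S := (faithfulSMul_iff_algebraMap_injective A S).2 hinj
    obtain ⟨P, hP, hP2⟩ := Ideal.exists_ideal_over_prime_of_isIntegral_of_isDomain (S := S)
      l.head.asIdeal (by
        rw [(RingHom.injective_iff_ker_eq_bot _).1 hinj]; exact bot_le)
    have : P.LiesOver (RelSeries.head l).asIdeal := ⟨hP2.symm⟩
    obtain ⟨L, h1, -⟩ := Ideal.exists_ltSeries_of_hasGoingUp l P
    rw [← h1]
    exact le_iSup (fun p : LTSeries (PrimeSpectrum S) => ((p.length : ℕ∞) : WithBot ℕ∞)) L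

theorem noether_norm {k R : Type} [Field k] [CommRing R] [IsDomain R] [Algebra k R]
    (hFG : Algebra.FiniteType k R) (d : ℕ) (hd : ringKrullDim R = d) :
    ∃ g : MvPolynomial (Fin d) k →ₐ[k] R, Function.Injective g ∧ g.Finite := by
  obtain ⟨s, g, hg, hf⟩ := exists_finite_inj_algHom_of_fg k R
  have : s = d := by
    let _ := g.toRingHom.toAlgebra
    have : Module.Finite (MvPolynomial (Fin s) k) R := hf
    have h := dim_eq_of_integral (A := MvPolynomial (Fin s) k) (S := R) hg
    rw [hd, MvPolynomial.ringKrullDim_of_isNoetherianRing, ringKrullDim_eq_zero_of_field] at h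
    have h2 : ((d : ℕ∞) : WithBot ℕ∞) = ((s : ℕ∞) : WithBot ℕ∞) := by simpa using h
    exact_mod_cast h2.symm
  subst this
  exact ⟨g, hg, hf⟩


/-- valuations trivial on `k`: value of scalar multiples -/
lemma val_smul {k R Γ : Type} [Field k] [CommRing R] [Algebra k R]
    [LinearOrderedCommGroupWithZero Γ] (v : Valuation R Γ)
    (hc : ∀ c : k, c ≠ 0 → v (algebraMap k R c) = 1) (c : k) (x : R) : v (c • x) ≤ v x := by
  by_cases h : c = 0
  · simp [h]
  · rw [Algebra.smul_def, map_mul, hc c h, one_mul]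

theorem adapted_basis {k R Γ : Type} [Field k] [CommRing R] [Algebra k R]
    [LinearOrderedCommGroupWithZero Γ] (v : Valuation R Γ) (hv : ∀ x, v x = 0 → x = 0)
    (hc : ∀ c : k, c ≠ 0 → v (algebraMap k R c) = 1) :
    ∀ (n : ℕ) (T : Submodule k R) [FiniteDimensional k T], Module.finrank k T = n →
    ∃ (ι : Type) (_ : Fintype ι) (u : ι → R), Fintype.card ι = n ∧ (∀ i, u i ∈ T) ∧
      (∀ i, u i ≠ 0) ∧
      ∀ c : ι → k, c ≠ 0 → ∀ γ, (∀ i, c i ≠ 0 → v (u i) = γ) → v (∑ i, c i • u i) = γ := by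
  intro n
  induction n using Nat.strong_induction_on with
  | _ n ih =>
  intro T _ hT
  by_cases hn : n = 0
  · subst hn
    refine ⟨Empty, inferInstance, Empty.elim, by simp, by simp, by simp, ?_⟩
    intro c h
    exact absurd (Subsingleton.elim _ _) h
  let b := Module.finBasis k T
  have : Nonempty (Fin (Module.finrank k T)) := ⟨⟨0, by omega⟩⟩
  obtain ⟨j, -, hj⟩ := Finset.univ.exists_max_image (fun i => v (b i : R)) Finset.univ_nonempty
  set γ := v (b j : R) with hγ
  have hbj : (b j : R) ≠ 0 := by
    have := b.ne_zero j
    simpa using this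
  have hγ0 : γ ≠ 0 := fun h => hbj (hv _ h)
  have hmax : ∀ x ∈ T, v x ≤ γ := by
    intro x hx
    have h1 : x = ∑ i, b.repr ⟨x, hx⟩ i • (b i : R) := by
      have := congrArg Subtype.val (b.sum_repr ⟨x, hx⟩)
      rw [Submodule.coe_sum] at this
      exact this.symm
    rw [h1]
    refine Valuation.map_sum_le v fun i _ => ?_
    exact (val_smul v hc _ _).trans (hj i (Finset.mem_univ _))
  let T' : Submodule k R :=
    { carrier := {x | x ∈ T ∧ v x < γ}
      zero_mem' := ⟨T.zero_mem, by rw [map_zero]; exact zero_lt_iff.2 hγ0⟩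
      add_mem' := fun {x y} hx hy => ⟨T.add_mem hx.1 hy.1, Valuation.map_add_lt v hx.2 hy.2⟩
      smul_mem' := fun c x hx => ⟨T.smul_mem c hx.1, (val_smul v hc _ _).trans_lt hx.2⟩ }
  have hT'T : T' ≤ T := fun x hx => hx.1
  have hlt : T' < T := lt_of_le_of_ne hT'T fun h => by
    have : (b j : R) ∈ T' := by rw [h]; exact (b j).2
    exact lt_irrefl _ this.2
  have : FiniteDimensional k T' := Submodule.finiteDimensional_of_le hT'T
  have hfin := Submodule.finrank_lt_finrank_of_lt hlt
  obtain ⟨ι, _, u, hu1, hu2, hu3, hu4⟩ := ih _ (hT ▸ hfin) T' rfl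
  obtain ⟨C0, hC0⟩ := Submodule.exists_isCompl T'
  let C := C0 ⊓ T
  have hCT : C ≤ T := inf_le_right
  have : FiniteDimensional k C := Submodule.finiteDimensional_of_le hCT
  have hinf : T' ⊓ C = ⊥ := by
    rw [eq_bot_iff, ← hC0.inf_eq_bot]
    exact inf_le_inf_left _ inf_le_left
  have hsup : T' ⊔ C = T := by
    change T' ⊔ C0 ⊓ T = T
    rw [← sup_inf_assoc_of_le _ hT'T, hC0.sup_eq_top, top_inf_eq]
  have hdim := Submodule.finrank_sup_add_finrank_inf_eq T' C
  rw [hinf, hsup, finrank_bot, add_zero, hT] at hdim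
  let e := Module.finBasis k C
  have hval : ∀ x ∈ C, x ≠ 0 → v x = γ := by
    intro x hx hx0
    refine le_antisymm (hmax x (hCT hx)) (not_lt.1 fun h => hx0 ?_)
    have : x ∈ T' ⊓ C := ⟨⟨hCT hx, h⟩, hx⟩
    rw [hinf] at this
    simpa using this
  have he0 : ∀ i, (e i : R) ≠ 0 := fun i => by
    have := e.ne_zero i
    simpa using this
  refine ⟨ι ⊕ Fin (Module.finrank k C), inferInstance, Sum.elim u (fun i => (e i : R)), ?_, ?_,
    ?_, ?_⟩
  · rw [Fintype.card_sum, hu1, Fintype.card_fin, hdim]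
  · rintro (i | i)
    · exact hT'T (hu2 i)
    · exact hCT (e i).2
  · rintro (i | i)
    · exact hu3 i
    · exact he0 i
  · intro c hc0 γ₀ h
    rw [Fintype.sum_sum_type]
    simp only [Sum.elim_inl, Sum.elim_inr]
    by_cases hg : γ₀ = γ
    · have hl : ∀ i, c (Sum.inl i) = 0 := by
        intro i
        by_contra hne
        have h1 := h _ hne
        rw [Sum.elim_inl, hg] at h1
        exact absurd h1 (hu2 i).2.ne
      simp only [hl, zero_smul, Finset.sum_const_zero, zero_add]
      rw [hg]
      apply hval
      · exact C.sum_mem fun i _ => C.smul_mem _ (e i).2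
      · intro h0
        have h1 : ∑ i, c (Sum.inr i) • e i = 0 := by
          apply Subtype.ext
          simpa using h0
        have h2 := Fintype.linearIndependent_iff.1 e.linearIndependent _ h1
        apply hc0
        ext (i | i)
        · exact hl i
        · exact h2 i
    · have hr : ∀ i, c (Sum.inr i) = 0 := by
        intro i
        by_contra hne
        have h1 := h _ hne
        rw [Sum.elim_inr, hval _ (e i).2 (he0 i)] at h1
        exact hg h1.symm
      simp only [hr, zero_smul, Finset.sum_const_zero, add_zero]
      refine hu4 (fun i => c (Sum.inl i)) ?_ γ₀ (fun i hi => h (Sum.inl i) hi)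
      intro h0
      apply hc0
      ext (i | i)
      · exact congrFun h0 i
      · exact hr i

lemma exp_distinct {Γ : Type} [LinearOrderedCommGroupWithZero Γ] {d : ℕ}
    (Y : (Fin d →₀ ℕ) → Γ) (hY0 : ∀ a, Y a ≠ 0) (hYadd : ∀ a b, Y (a + b) = Y a * Y b)
    (hYs : ∀ (n : ℕ) a, Y (n • a) = Y a ^ n)
    (hYi : Function.Injective Y) (e N : ℕ) (hN : 0 < N) (hcop : Nat.Coprime N e)
    (γ γ' : Γ)
    (hγ : ∃ α α', γ ^ e * Y α = Y α') (hγ' : ∃ α α', γ' ^ e * Y α = Y α')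
    (β β' : Fin d →₀ ℕ) (hβ : ∀ i, β i < N) (hβ' : ∀ i, β' i < N)
    (h : γ ^ N * Y β = γ' ^ N * Y β') : γ = γ' ∧ β = β' := by
  obtain ⟨α, α', h1⟩ := hγ
  obtain ⟨δ, δ', h2⟩ := hγ'
  have h3 : (γ ^ e) ^ N * Y (N • α) = Y (N • α') := by rw [hYs, hYs, ← mul_pow, h1]
  have h4 : (γ' ^ e) ^ N * Y (N • δ) = Y (N • δ') := by rw [hYs, hYs, ← mul_pow, h2]
  have h5 : (γ ^ e) ^ N * Y (e • β) = (γ' ^ e) ^ N * Y (e • β') := by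
    rw [hYs, hYs, ← pow_mul, ← pow_mul, mul_comm e N, pow_mul, pow_mul, ← mul_pow, ← mul_pow, h]
  have h6 : N • α' + e • β + N • δ = N • δ' + e • β' + N • α := by
    apply hYi
    simp only [hYadd]
    rw [← h3, ← h4]
    calc _ = ((γ ^ e) ^ N * Y (e • β)) * (Y (N • α) * Y (N • δ)) := by ac_rfl
      _ = _ := by rw [h5]; ac_rfl
  have hββ : β = β' := by
    ext i
    have h7 : N * α' i + e * β i + N * δ i = N * δ' i + e * β' i + N * α i := by
      have := DFunLike.congr_fun h6 i
      simpa using this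
    have h8 : e * β i ≡ e * β' i [MOD N] := by
      have h9 : (N * α' i + e * β i + N * δ i) % N = (N * δ' i + e * β' i + N * α i) % N := by
        rw [h7]
      simpa [Nat.ModEq] using h9
    have h10 : β i ≡ β' i [MOD N] := Nat.ModEq.cancel_left_of_coprime hcop h8
    exact Nat.ModEq.eq_of_lt_of_lt h10 (hβ i) (hβ' i)
  refine ⟨?_, hββ⟩
  subst hββ
  have := mul_right_cancel₀ (hY0 β) h
  exact (pow_left_inj₀ zero_le zero_le hN.ne').1 this


lemma pow_mem_family {k R : Type} [Field k] [CommRing R] [Algebra k R] (T : ℕ → Submodule k R)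
    (hT1 : 1 ∈ T 0) (hTmul : ∀ p q x y, x ∈ T p → y ∈ T q → x * y ∈ T (p + q))
    (p : ℕ) (x : R) (hx : x ∈ T p) (n : ℕ) : x ^ n ∈ T (p * n) := by
  induction n with
  | zero => simpa using hT1
  | succ n ih =>
    rw [pow_succ, Nat.mul_succ]
    exact hTmul _ _ _ _ ih hx

theorem growth {k R : Type} [Field k] [CommRing R] [IsDomain R] [Algebra k R] {d : ℕ}
    (φ : MvPolynomial (Fin d) k →ₐ[k] R) (hφ : Function.Injective φ)
    (hphi_int : φ.toRingHom.IsIntegral) (T : ℕ → Submodule k R) (hfd : ∀ n, FiniteDimensional k (T n))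
    (hT1 : 1 ∈ T 0) (hTmul : ∀ p q x y, x ∈ T p → y ∈ T q → x * y ∈ T (p + q))
    (h : R) (hh : h ≠ 0)
    (hTh : ∀ N, 0 < N → ∀ β : Fin d →₀ ℕ, (∀ i, β i < N) →
      h ^ N * φ (MvPolynomial.monomial β 1) ∈ T N) (p : ℕ) :
    ∃ e, 0 < e ∧ ∀ N, 0 < N → Nat.Coprime N e →
      N ^ d * Module.finrank k (T p) ≤ Module.finrank k (T ((p + 1) * N)) := by
  obtain ⟨Γ, _, v, hv0, hvc, hvi, hve⟩ := exists_val φ hφ hphi_int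
  obtain ⟨ι, _, u, hu1, hu2, hu3, hu4⟩ := adapted_basis v hv0 hvc _ (T p) rfl
  by_cases hι : IsEmpty ι
  · refine ⟨1, one_pos, fun N _ _ => ?_⟩
    rw [← hu1, Fintype.card_eq_zero]; simp
  rw [not_isEmpty_iff] at hι
  choose e he α α' hα using fun i => hve (u i) (hu3 i)
  refine ⟨∏ i, e i, Finset.prod_pos fun i _ => he i, fun N hN hcop => ?_⟩
  classical
  let Y : (Fin d →₀ ℕ) → Γ := fun a => v (φ (MvPolynomial.monomial a 1))
  have hYadd : ∀ a b, Y (a + b) = Y a * Y b := by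
    intro a b
    change v _ = v _ * v _
    rw [← map_mul, ← map_mul, MvPolynomial.monomial_mul, one_mul]
  have hYs : ∀ (n : ℕ) a, Y (n • a) = Y a ^ n := by
    intro n a
    change v _ = v _ ^ n
    rw [← map_pow, ← map_pow, MvPolynomial.monomial_pow, one_pow]
  have hφ0 : ∀ a, a ≠ 0 → φ a ≠ 0 := fun a ha h => ha (hφ (by rw [h, map_zero]))
  have hY0 : ∀ a, Y a ≠ 0 := fun a h => hφ0 _ (by simp) (hv0 _ h)
  have hYi : Function.Injective Y := fun a b h => hvi a b h
  let f : ι → Γ := fun i => v (u i)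
  have hf0 : ∀ i, f i ≠ 0 := fun i h => hu3 i (hv0 _ h)
  have hexp : ∀ i, ∃ a a', f i ^ (∏ i, e i) * Y a = Y a' := by
    intro i
    obtain ⟨t, ht⟩ := Finset.dvd_prod_of_mem e (Finset.mem_univ i)
    refine ⟨t • α i, t • α' i, ?_⟩
    rw [ht, hYs, hYs, pow_mul, ← mul_pow, hα]
  let r : Γ → ι := Function.invFun f
  have hr : ∀ i, f (r (f i)) = f i := fun i => Function.invFun_eq ⟨i, rfl⟩
  let B := Fin d → Fin N
  let bt : B → (Fin d →₀ ℕ) := fun β => Finsupp.equivFunOnFinite.symm fun i => (β i : ℕ)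
  have hbt : Function.Injective bt := by
    intro β β' h
    have h2 := Finsupp.equivFunOnFinite.symm.injective h
    funext i
    exact Fin.ext (congrFun h2 i)
  have hbtlt : ∀ β i, bt β i < N := fun β i => (β i).2
  let y : B → R := fun β => φ (MvPolynomial.monomial (bt β) 1)
  let W : ι × B → R := fun x => u x.1 * u (r (f x.1)) ^ (N - 1) * (h ^ N * y x.2)
  have hW : ∀ x, W x ∈ T ((p + 1) * N) := by
    intro x
    have h1 := hTmul _ _ _ _ (hTmul _ _ _ _ (hu2 x.1)
      (pow_mem_family T hT1 hTmul p _ (hu2 (r (f x.1))) (N - 1))) (hTh N hN (bt x.2) (hbtlt x.2))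
    have h2 : p + p * (N - 1) + N = (p + 1) * N := by
      obtain ⟨M, rfl⟩ : ∃ M, N = M + 1 := ⟨N - 1, by omega⟩
      rw [Nat.add_sub_cancel]; ring
    rw [h2] at h1
    exact h1
  have hlin : LinearIndependent k W := by
    rw [Fintype.linearIndependent_iff]
    intro c hc
    by_contra! hcon
    obtain ⟨⟨i₀, β₀⟩, hne⟩ := hcon
    let S : Γ × B → R := fun x =>
      (∑ i, (if f i = x.1 then c (i, x.2) else 0) • u i) * u (r x.1) ^ (N - 1) * (h ^ N * y x.2)
    let s : Finset (Γ × B) := (Finset.univ.image fun x : ι × B => (f x.1, x.2)).filter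
      fun x => ∃ i, f i = x.1 ∧ c (i, x.2) ≠ 0
    have hs : s.Nonempty := ⟨(f i₀, β₀), by
      rw [Finset.mem_filter]
      exact ⟨Finset.mem_image.2 ⟨(i₀, β₀), Finset.mem_univ _, rfl⟩, i₀, rfl, hne⟩⟩
    have hsum : ∑ x ∈ s, S x = 0 := by
      rw [← hc]
      have h1 : ∑ x ∈ s, S x = ∑ x ∈ Finset.univ.image fun x : ι × B => (f x.1, x.2), S x := by
        refine Finset.sum_subset (Finset.filter_subset _ _) ?_
        intro x hx hxs
        have : ∀ i, (if f i = x.1 then c (i, x.2) else 0) = 0 := by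
          intro i
          by_contra hne'
          apply hxs
          rw [Finset.mem_filter]
          refine ⟨hx, i, ?_⟩
          by_cases hfi : f i = x.1
          · rw [if_pos hfi] at hne'; exact ⟨hfi, hne'⟩
          · rw [if_neg hfi] at hne'; exact absurd rfl hne'
        simp only [S, this, zero_smul, Finset.sum_const_zero, zero_mul]
      rw [h1, ← Finset.sum_fiberwise_of_maps_to (s := Finset.univ)
        (t := Finset.univ.image fun x : ι × B => (f x.1, x.2)) (g := fun x : ι × B => (f x.1, x.2))
        (fun x _ => Finset.mem_image_of_mem _ (Finset.mem_univ _))]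
      refine Finset.sum_congr rfl fun x _ => ?_
      rw [Finset.sum_filter, Fintype.sum_prod_type]
      simp only [S]
      rw [Finset.sum_mul, Finset.sum_mul]
      refine Finset.sum_congr rfl fun i _ => ?_
      rw [Finset.sum_eq_single x.2]
      · by_cases hfi : f i = x.1
        · rw [if_pos hfi, if_pos (show (f i, x.2) = x from Prod.ext hfi rfl)]
          simp only [W, hfi, smul_mul_assoc]
        · rw [if_neg hfi, if_neg (fun hx => hfi (congrArg Prod.fst hx))]
          simp
      · intro b _ hb
        rw [if_neg (fun hx => hb (congrArg Prod.snd hx))]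
      · intro hx; exact absurd (Finset.mem_univ _) hx
    have hval : ∀ x ∈ s, v (S x) = (x.1 ^ N * Y (bt x.2)) * v h ^ N := by
      intro x hx
      obtain ⟨i, hi, hci⟩ := (Finset.mem_filter.1 hx).2
      have h1 : v (∑ i, (if f i = x.1 then c (i, x.2) else 0) • u i) = x.1 := by
        refine hu4 _ ?_ _ ?_
        · intro h0
          have := congrFun h0 i
          rw [if_pos hi] at this
          exact hci this
        · intro i' hi'
          by_contra hne'
          exact hi' (if_neg hne')
      have h2 : v (u (r x.1)) = x.1 := by
        rw [← hi]; exact hr i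
      simp only [S]
      rw [map_mul, map_mul, map_mul, h1, map_pow, map_pow, h2, ← pow_succ', Nat.sub_add_cancel hN]
      change _ * (_ * Y (bt x.2)) = _
      ac_rfl
    have hvh : v h ≠ 0 := fun h0 => hh (hv0 _ h0)
    obtain ⟨x, hx, hvx⟩ := val_sum_distinct v s hs S (by
      intro x hx x' hx' heq
      rw [hval x hx, hval x' hx'] at heq
      have h1 := mul_right_cancel₀ (pow_ne_zero N hvh) heq
      obtain ⟨i, hi, -⟩ := (Finset.mem_filter.1 hx).2
      obtain ⟨i', hi', -⟩ := (Finset.mem_filter.1 hx').2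
      obtain ⟨h2, h3⟩ := exp_distinct Y hY0 hYadd hYs hYi (∏ i, e i) N hN hcop x.1 x'.1
        (hi ▸ hexp i) (hi' ▸ hexp i') (bt x.2) (bt x'.2) (hbtlt _) (hbtlt _) h1
      exact Prod.ext h2 (hbt h3))
    rw [hsum, map_zero, hval x hx] at hvx
    obtain ⟨i, hi, -⟩ := (Finset.mem_filter.1 hx).2
    exact mul_ne_zero (mul_ne_zero (pow_ne_zero N (hi ▸ hf0 i)) (hY0 _)) (pow_ne_zero N hvh) hvx.symm
  have hlin' : LinearIndependent k (fun x => (⟨W x, hW x⟩ : T ((p + 1) * N))) :=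
    LinearIndependent.of_comp (T ((p + 1) * N)).subtype hlin
  have := hlin'.fintype_card_le_finrank
  rw [Fintype.card_prod, hu1, Fintype.card_fun, Fintype.card_fin, Fintype.card_fin] at this
  rw [mul_comm]; exact this


/-- the real analysis lemma -/
theorem limit_exists (d : ℕ) (a : ℕ → ℕ) (hmono : ∀ n, 1 ≤ n → a n ≤ a (n + 1))
    (hgrow : ∀ p, 1 ≤ p → ∃ e, 0 < e ∧ ∀ N, 0 < N → Nat.Coprime N e →
      N ^ d * a p ≤ a ((p + 1) * N))
    (C : ℝ) (hC : ∀ n, 1 ≤ n → (a n : ℝ) ≤ C * (n : ℝ) ^ d) :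
    ∃ L : ℝ, Tendsto (fun n : ℕ => (a n : ℝ) / (n : ℝ) ^ d) atTop (nhds L) := by
  have hmono' : ∀ m n, 1 ≤ m → m ≤ n → a m ≤ a n := by
    intro m n hm hmn
    induction n, hmn using Nat.le_induction with
    | base => exact le_rfl
    | succ n hn ih => exact ih.trans (hmono n (hm.trans hn))
  let F : ℕ → ℝ := fun n => (a n : ℝ) / (n : ℝ) ^ d
  let G : ℕ → ℝ := fun p => (a (p + 1) : ℝ) / ((p : ℝ) + 2) ^ d
  have hFC : ∀ n, 1 ≤ n → F n ≤ C := by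
    intro n hn
    have : (0:ℝ) < (n:ℝ) ^ d := by positivity
    exact (div_le_iff₀ this).2 (hC n hn)
  have hC0 : 0 ≤ C := le_trans (by positivity) (hFC 1 le_rfl)
  have hGC : ∀ p, G p ≤ C := by
    intro p
    refine le_trans ?_ (hFC (p + 1) (by omega))
    simp only [G, F]
    have : (0:ℝ) < ((p + 1 : ℕ) : ℝ) ^ d := by positivity
    apply div_le_div_of_nonneg_left (by positivity) this
    push_cast
    gcongr
    norm_num
  have hbdd : BddAbove (Set.range G) := ⟨C, by rintro _ ⟨p, rfl⟩; exact hGC p⟩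
  let L := ⨆ p, G p
  have hGL : ∀ p, G p ≤ L := fun p => le_ciSup hbdd p
  refine ⟨L, ?_⟩
  -- the upper comparison: `F (p+1) = G p * ((p+2)/(p+1))^d`
  have hup : ∀ n, 1 ≤ n → F n ≤ L * (((n:ℝ) + 1) / n) ^ d := by
    intro n hn
    obtain ⟨p, rfl⟩ : ∃ p, n = p + 1 := ⟨n - 1, by omega⟩
    have h1 : F (p + 1) = G p * ((((p + 1 : ℕ):ℝ) + 1) / ((p + 1 : ℕ) : ℝ)) ^ d := by
      simp only [F, G]
      rw [div_pow]
      push_cast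
      have h2 : ((p:ℝ) + 1 + 1) = p + 2 := by ring
      rw [h2]
      have : ((p:ℝ) + 2) ^ d ≠ 0 := by positivity
      have : ((p:ℝ) + 1) ^ d ≠ 0 := by positivity
      field_simp
    rw [h1]
    gcongr
    exact hGL p
  have hlim1 : Tendsto (fun n : ℕ => L * (((n:ℝ) + 1) / n) ^ d) atTop (nhds L) := by
    have h1 : Tendsto (fun n : ℕ => ((n:ℝ) + 1) / n) atTop (nhds 1) := by
      have h2 : Tendsto (fun n : ℕ => 1 + 1 / (n:ℝ)) atTop (nhds (1 + 0)) :=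
        tendsto_const_nhds.add tendsto_one_div_atTop_nhds_zero_nat
      rw [add_zero] at h2
      refine h2.congr' ?_
      filter_upwards [eventually_ge_atTop 1] with n hn
      have : (n:ℝ) ≠ 0 := by positivity
      field_simp
    have h3 := (h1.pow d).const_mul L
    simpa using h3
  -- the lower comparison
  have hlow : ∀ p, ∃ M : ℕ, 0 < M ∧ ∀ n, 2 * M ≤ n →
      G p * (((n:ℝ) - 2 * M) / n) ^ d ≤ F n := by
    intro p
    obtain ⟨e, he, hN⟩ := hgrow (p + 1) (by omega)
    refine ⟨(p + 2) * e, by positivity, fun n hn => ?_⟩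
    set M := (p + 2) * e with hM
    have hMpos : 0 < M := by positivity
    let q := n / M
    have hq : 2 ≤ q := (Nat.le_div_iff_mul_le hMpos).2 hn
    let N := (q - 1) * e + 1
    have hcop : Nat.Coprime N e := by simp [N]
    have h1 := hN N (by omega) hcop
    have hqe : (p + 2) * N ≤ q * M := by
      have : q * M = (p + 2) * ((q - 1) * e + e) := by
        obtain ⟨t, ht⟩ : ∃ t, q = t + 1 := ⟨q - 1, by omega⟩
        rw [ht, hM]; simp; ring
      rw [this]
      exact Nat.mul_le_mul_left _ (by simp only [N]; omega)
    have hqn : q * M ≤ n := Nat.div_mul_le_self n M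
    have h2 : N ^ d * a (p + 1) ≤ a n :=
      h1.trans (hmono' _ _ (Nat.mul_pos (by omega) (Nat.succ_pos _)) (hqe.trans hqn))
    have h3 : (n:ℝ) - 2 * M ≤ (p + 2) * N := by
      have h4 : n < (q + 1) * M := by
        rw [mul_comm]; exact Nat.lt_mul_div_succ n hMpos
      have h5 : (q + 1) * M ≤ (p + 2) * N + 2 * M := by
        obtain ⟨t, ht⟩ : ∃ t, q = t + 1 := ⟨q - 1, by omega⟩
        simp only [N, ht, hM, Nat.add_sub_cancel]
        nlinarith
      have h6 : n ≤ (p + 2) * N + 2 * M := (h4.trans_le h5).le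
      have h7 : (n:ℝ) ≤ (p + 2) * N + 2 * M := by exact_mod_cast h6
      linarith
    have h8 : (0:ℝ) ≤ (n:ℝ) - 2 * M := by
      have : (2 * M : ℝ) ≤ n := by exact_mod_cast hn
      linarith
    have hn0 : (0:ℝ) < n := by
      have : 0 < n := by omega
      exact_mod_cast this
    simp only [F, G]
    rw [div_pow, div_mul_div_comm, div_le_div_iff₀ (by positivity) (by positivity)]
    have h9 : ((n:ℝ) - 2 * M) ^ d ≤ ((p + 2) * N) ^ d := pow_le_pow_left₀ h8 h3 d
    have h10 : ((N:ℝ) ^ d * a (p + 1)) ≤ a n := by exact_mod_cast h2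
    calc (a (p + 1) : ℝ) * ((n:ℝ) - 2 * M) ^ d * n ^ d
        ≤ a (p + 1) * ((p + 2) * N) ^ d * n ^ d := by gcongr
      _ = (N ^ d * a (p + 1)) * ((p + 2) ^ d * n ^ d) := by rw [mul_pow]; ring
      _ ≤ a n * ((p + 2) ^ d * n ^ d) := by gcongr
  have hlim2 : ∀ p (M : ℕ), Tendsto (fun n : ℕ => G p * (((n:ℝ) - 2 * M) / n) ^ d) atTop
      (nhds (G p)) := by
    intro p M
    have h1 : Tendsto (fun n : ℕ => ((n:ℝ) - 2 * M) / n) atTop (nhds 1) := by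
      have h2 : Tendsto (fun n : ℕ => 1 - (2 * M) * (1 / (n:ℝ))) atTop (nhds (1 - (2 * M) * 0)) :=
        tendsto_const_nhds.sub (tendsto_one_div_atTop_nhds_zero_nat.const_mul _)
      rw [mul_zero, sub_zero] at h2
      refine h2.congr' ?_
      filter_upwards [eventually_ge_atTop 1] with n hn
      have : (n:ℝ) ≠ 0 := by positivity
      field_simp
    have h3 := (h1.pow d).const_mul (G p)
    simpa using h3
  rw [tendsto_order]
  constructor
  · intro l hl
    obtain ⟨p, hp⟩ := exists_lt_of_lt_ciSup hl
    obtain ⟨M, hM, hMn⟩ := hlow p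
    have h1 := (tendsto_order.1 (hlim2 p M)).1 l hp
    filter_upwards [h1, eventually_ge_atTop (2 * M)] with n hn1 hn2
    exact hn1.trans_le (hMn n hn2)
  · intro l hl
    have h1 := (tendsto_order.1 hlim1).2 l hl
    filter_upwards [h1, eventually_ge_atTop 1] with n hn1 hn2
    exact (hup n hn2).trans_lt hn1


section
variable {k R : Type} [Field k] [CommRing R] [Algebra k R] {d s : ℕ}
    (φ : MvPolynomial (Fin d) k →ₐ[k] R) (e : Fin s → R)

/-- span of `y^α e_l` with exponents `≤ D` -/
def Wsp (D : ℕ) : Submodule k R :=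
  Submodule.span k (Set.range fun x : (Fin d → Fin (D + 1)) × Fin s =>
    φ (MvPolynomial.monomial (Finsupp.equivFunOnFinite.symm fun i => (x.1 i : ℕ)) 1) * e x.2)

instance (D : ℕ) : FiniteDimensional k (Wsp φ e D) :=
  FiniteDimensional.span_of_finite k (Set.finite_range _)

lemma Wsp_mem (D : ℕ) (α : Fin d →₀ ℕ) (hα : ∀ i, α i ≤ D) (l : Fin s) :
    φ (MvPolynomial.monomial α 1) * e l ∈ Wsp φ e D := by
  refine Submodule.subset_span ⟨(fun i => ⟨α i, Nat.lt_succ_of_le (hα i)⟩, l), ?_⟩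
  have h : (Finsupp.equivFunOnFinite.symm fun i => α i) = α :=
    Finsupp.equivFunOnFinite.symm_apply_apply α
  dsimp only
  rw [h]

lemma Wsp_induct (D : ℕ) (p : Submodule k R)
    (h : ∀ α : Fin d →₀ ℕ, (∀ i, α i ≤ D) → ∀ l, φ (MvPolynomial.monomial α 1) * e l ∈ p) :
    Wsp φ e D ≤ p := by
  refine Submodule.span_le.2 ?_
  rintro _ ⟨⟨α, l⟩, rfl⟩
  exact h _ (fun i => Nat.le_of_lt_succ (α i).2) l

lemma Wsp_mono {D D' : ℕ} (h : D ≤ D') : Wsp φ e D ≤ Wsp φ e D' :=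
  Wsp_induct φ e D _ fun α hα l => Wsp_mem φ e D' α (fun i => (hα i).trans h) l

lemma Wsp_mul (D D' : ℕ) (α : Fin d →₀ ℕ) (hα : ∀ i, α i ≤ D) (x : R) (hx : x ∈ Wsp φ e D') :
    φ (MvPolynomial.monomial α 1) * x ∈ Wsp φ e (D + D') := by
  have : Wsp φ e D' ≤ (Wsp φ e (D + D')).comap
      (LinearMap.mulLeft k (φ (MvPolynomial.monomial α 1))) := by
    refine Wsp_induct φ e D' _ fun β hβ l => ?_
    change φ (MvPolynomial.monomial α 1) * (φ (MvPolynomial.monomial β 1) * e l) ∈ Wsp φ e (D + D')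
    rw [← mul_assoc, ← map_mul, MvPolynomial.monomial_mul, one_mul]
    exact Wsp_mem φ e _ _ (fun i => add_le_add (hα i) (hβ i)) l
  exact this hx

lemma Wsp_finrank (D : ℕ) : Module.finrank k (Wsp φ e D) ≤ (D + 1) ^ d * s := by
  have := finrank_range_le_card (R := k) (fun x : (Fin d → Fin (D + 1)) × Fin s =>
    φ (MvPolynomial.monomial (Finsupp.equivFunOnFinite.symm fun i => (x.1 i : ℕ)) 1) * e x.2)
  rw [Set.finrank, Fintype.card_prod, Fintype.card_fun, Fintype.card_fin, Fintype.card_fin,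
    Fintype.card_fin] at this
  exact this

lemma Wsp_exists_term (a : MvPolynomial (Fin d) k) (l : Fin s) : ∃ D, φ a * e l ∈ Wsp φ e D := by
  classical
  induction a using MvPolynomial.induction_on' with
  | monomial α c =>
    refine ⟨α.support.sup α, ?_⟩
    have : MvPolynomial.monomial α c = c • MvPolynomial.monomial α (1:k) := by
      rw [MvPolynomial.smul_monomial, smul_eq_mul, mul_one]
    rw [this, map_smul, smul_mul_assoc]
    refine Submodule.smul_mem _ _ (Wsp_mem φ e _ α (fun i => ?_) l)
    by_cases hi : i ∈ α.support
    · exact Finset.le_sup (f := α) hi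
    · rw [Finsupp.notMem_support_iff.1 hi]; exact Nat.zero_le _
  | add a b ha hb =>
    obtain ⟨D, hD⟩ := ha
    obtain ⟨D', hD'⟩ := hb
    refine ⟨max D D', ?_⟩
    rw [map_add, add_mul]
    exact Submodule.add_mem _ (Wsp_mono φ e (le_max_left _ _) hD)
      (Wsp_mono φ e (le_max_right _ _) hD')

lemma Wsp_exists (he : ∀ x : R, ∃ a : Fin s → MvPolynomial (Fin d) k, x = ∑ l, φ (a l) * e l)
    (x : R) : ∃ D, x ∈ Wsp φ e D := by
  obtain ⟨a, rfl⟩ := he x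
  choose D hD using fun l => Wsp_exists_term φ e (a l) l
  exact ⟨Finset.univ.sup D, Submodule.sum_mem _ fun l _ =>
    Wsp_mono φ e (Finset.le_sup (Finset.mem_univ l)) (hD l)⟩

lemma exists_fin_gens (hf : φ.Finite) :
    ∃ (s : ℕ) (e : Fin s → R), ∀ x : R, ∃ a : Fin s → MvPolynomial (Fin d) k,
      x = ∑ l, φ (a l) * e l := by
  let _ := φ.toRingHom.toAlgebra
  have : Module.Finite (MvPolynomial (Fin d) k) R := hf
  obtain ⟨s, e, he⟩ := Module.Finite.exists_fin (R := MvPolynomial (Fin d) k) (M := R)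
  refine ⟨s, e, fun x => ?_⟩
  have hx : x ∈ Submodule.span (MvPolynomial (Fin d) k) (Set.range e) := by rw [he]; trivial
  obtain ⟨a, ha⟩ := (Submodule.mem_span_range_iff_exists_fun _).1 hx
  exact ⟨a, ha.symm⟩

theorem dim_pow_bound (hf : φ.Finite) (V : Submodule k R) (hV : V.FG) :
    ∃ C : ℕ, ∀ n, 1 ≤ n → Module.finrank k (V ^ n : Submodule k R) ≤ C * n ^ d := by
  obtain ⟨s, e, he⟩ := exists_fin_gens φ hf
  obtain ⟨t, rfl⟩ := hV
  choose D hD using Wsp_exists φ e he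
  let D0 := max (D 1) (t.sup fun v => Finset.univ.sup fun l => D (v * e l))
  have h1 : (1 : R) ∈ Wsp φ e D0 := Wsp_mono φ e (le_max_left _ _) (hD 1)
  have h2 : ∀ v ∈ t, ∀ l, v * e l ∈ Wsp φ e D0 := by
    intro v hv l
    refine Wsp_mono φ e (le_trans ?_ (le_max_right _ _)) (hD (v * e l))
    exact (Finset.le_sup (f := fun l => D (v * e l)) (Finset.mem_univ l)).trans
      (Finset.le_sup (f := fun v => Finset.univ.sup fun l => D (v * e l)) hv)
  have h3 : ∀ D, Submodule.span k (t : Set R) * Wsp φ e D ≤ Wsp φ e (D + D0) := by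
    intro D
    rw [Submodule.mul_le]
    intro v hv w hw
    induction hv using Submodule.span_induction with
    | mem v hv =>
      have : Wsp φ e D ≤ (Wsp φ e (D + D0)).comap (LinearMap.mulLeft k v) := by
        refine Wsp_induct φ e D _ fun α hα l => ?_
        change v * (φ (MvPolynomial.monomial α 1) * e l) ∈ Wsp φ e (D + D0)
        rw [mul_left_comm]
        exact Wsp_mul φ e D D0 α hα _ (h2 v hv l)
      exact this hw
    | zero => rw [zero_mul]; exact Submodule.zero_mem _
    | add x y _ _ hx hy => rw [add_mul]; exact Submodule.add_mem _ hx hy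
    | smul c x _ hx => rw [smul_mul_assoc]; exact Submodule.smul_mem _ _ hx
  have h4 : ∀ n, Submodule.span k (t : Set R) ^ n * Wsp φ e D0 ≤ Wsp φ e (D0 + n * D0) := by
    intro n
    induction n with
    | zero => rw [pow_zero, one_mul, zero_mul, add_zero]
    | succ n ih =>
      rw [pow_succ', mul_assoc]
      refine (mul_le_mul' le_rfl ih).trans ((h3 _).trans ?_)
      rw [Nat.succ_mul, add_assoc]
  refine ⟨(2 * D0 + 1) ^ d * s, fun n hn => ?_⟩
  have h5 : Submodule.span k (t : Set R) ^ n ≤ Wsp φ e (D0 + n * D0) := by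
    intro x hx
    have := h4 n (Submodule.mul_mem_mul hx h1)
    rwa [mul_one] at this
  calc _ ≤ Module.finrank k (Wsp φ e (D0 + n * D0)) := Submodule.finrank_mono h5
    _ ≤ (D0 + n * D0 + 1) ^ d * s := Wsp_finrank φ e _
    _ ≤ ((2 * D0 + 1) * n) ^ d * s := by
        gcongr
        nlinarith
    _ = _ := by rw [mul_pow]; ring
end


section LowDeg
variable {k R : Type} [Field k] [CommRing R] [Algebra k R]
    (𝒜 : ℕ → Submodule k R) [GradedAlgebra 𝒜]

/-- elements all of whose components have degree at most `a` -/
def lowDeg (a : ℕ) : Submodule k R where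
  carrier := {x | ∀ i, a < i → (DirectSum.decompose 𝒜 x i : R) = 0}
  zero_mem' := by intro i _; simp
  add_mem' := by
    intro x y hx hy i hi
    rw [DirectSum.decompose_add, DirectSum.add_apply, Submodule.coe_add, hx i hi, hy i hi, add_zero]
  smul_mem' := by
    intro c x hx i hi
    rw [DirectSum.decompose_smul, DirectSum.smul_apply, Submodule.coe_smul, hx i hi, smul_zero]

lemma mem_lowDeg {a : ℕ} {x : R} :
    x ∈ lowDeg 𝒜 a ↔ ∀ i, a < i → (DirectSum.decompose 𝒜 x i : R) = 0 := Iff.rfl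

lemma lowDeg_mono {a b : ℕ} (h : a ≤ b) : lowDeg 𝒜 a ≤ lowDeg 𝒜 b :=
  fun _ hx i hi => hx i (h.trans_lt hi)

lemma mem_lowDeg_of_mem {i a : ℕ} (h : i ≤ a) {x : R} (hx : x ∈ 𝒜 i) : x ∈ lowDeg 𝒜 a :=
  fun j hj => DirectSum.decompose_of_mem_ne 𝒜 hx (by omega)

lemma one_mem_lowDeg : (1 : R) ∈ lowDeg 𝒜 0 :=
  mem_lowDeg_of_mem 𝒜 le_rfl SetLike.GradedOne.one_mem

lemma mul_mem_lowDeg {a b : ℕ} {x y : R} (hx : x ∈ lowDeg 𝒜 a) (hy : y ∈ lowDeg 𝒜 b) :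
    x * y ∈ lowDeg 𝒜 (a + b) := by
  classical
  intro i hi
  rw [DirectSum.decompose_mul, DirectSum.coe_mul_apply]
  refine Finset.sum_eq_zero fun p hp => ?_
  have hp2 := (Finset.mem_filter.1 hp).2
  by_cases h : a < p.1
  · rw [hx _ h, zero_mul]
  · rw [hy p.2 (by omega), mul_zero]

lemma pow_mem_lowDeg {a : ℕ} {x : R} (hx : x ∈ lowDeg 𝒜 a) (n : ℕ) :
    x ^ n ∈ lowDeg 𝒜 (a * n) :=
  pow_mem_family (fun n => lowDeg 𝒜 n) (one_mem_lowDeg 𝒜)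
    (fun _ _ _ _ hx hy => mul_mem_lowDeg 𝒜 hx hy) a x hx n

lemma exists_lowDeg (x : R) : ∃ a, x ∈ lowDeg 𝒜 a := by
  classical
  refine ⟨(DirectSum.decompose 𝒜 x).support.sup id, fun i hi => ?_⟩
  by_contra h
  have : i ∈ (DirectSum.decompose 𝒜 x).support := by
    rw [DFinsupp.mem_support_iff]
    intro h0
    exact h (by rw [h0]; rfl)
  exact absurd (Finset.le_sup (f := id) this) (not_le.2 hi)

lemma component_mem_pow' (hstd : Algebra.adjoin k (𝒜 1 : Set R) = ⊤) (r : R) :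
    ∀ i, (DirectSum.decompose 𝒜 r i : R) ∈ (𝒜 1) ^ i := by
  classical
  have hr : r ∈ Algebra.adjoin k (𝒜 1 : Set R) := by rw [hstd]; trivial
  induction hr using Algebra.adjoin_induction with
  | mem x hx =>
    intro i
    by_cases hi : i = 1
    · subst hi
      rw [DirectSum.decompose_of_mem_same 𝒜 hx, pow_one]
      exact hx
    · rw [DirectSum.decompose_of_mem_ne 𝒜 hx (Ne.symm hi)]; exact zero_mem _
  | algebraMap c =>
    intro i
    by_cases hi : i = 0
    · subst hi
      rw [DirectSum.decompose_of_mem_same 𝒜 (SetLike.algebraMap_mem_graded 𝒜 c), pow_zero]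
      exact Submodule.algebraMap_mem c
    · rw [DirectSum.decompose_of_mem_ne 𝒜 (SetLike.algebraMap_mem_graded 𝒜 c) (Ne.symm hi)]
      exact zero_mem _
  | add x y _ _ hx hy =>
    intro i
    rw [DirectSum.decompose_add]
    exact Submodule.add_mem _ (hx i) (hy i)
  | mul x y _ _ hx hy =>
    intro i
    rw [DirectSum.decompose_mul, DirectSum.coe_mul_apply]
    refine Submodule.sum_mem _ fun p hp => ?_
    rw [← (Finset.mem_filter.1 hp).2, pow_add]
    exact Submodule.mul_mem_mul (hx _) (hy _)

lemma lowDeg_le_pow (hstd : Algebra.adjoin k (𝒜 1 : Set R) = ⊤) (a : ℕ) :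
    lowDeg 𝒜 a ≤ (1 ⊔ 𝒜 1) ^ a := by
  classical
  intro x hx
  rw [← DirectSum.sum_support_decompose 𝒜 x]
  refine Submodule.sum_mem _ fun i hi => ?_
  have hia : i ≤ a := by
    by_contra h
    rw [DFinsupp.mem_support_iff] at hi
    exact hi (Subtype.ext (hx i (not_le.1 h)))
  have h1 : (𝒜 1) ^ i ≤ (1 ⊔ 𝒜 1) ^ i := pow_le_pow_left' le_sup_right i
  have h2 : (1 ⊔ 𝒜 1) ^ i ≤ (1 ⊔ 𝒜 1) ^ a := pow_le_pow_right' le_sup_left hia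
  exact h2 (h1 (component_mem_pow' 𝒜 hstd x i))

lemma deg_one_fg [IsNoetherianRing R] (hstd : Algebra.adjoin k (𝒜 1 : Set R) = ⊤) :
    (𝒜 1).FG := by
  classical
  have h1 : (Ideal.span (𝒜 1 : Set R)).FG := IsNoetherian.noetherian _
  obtain ⟨t, ht, hspan⟩ := (Submodule.fg_span_iff_fg_span_finset_subset (R := R) (M := R) _).1 h1
  refine ⟨t, le_antisymm (Submodule.span_le.2 ht) ?_⟩
  intro x hx
  have hx' : x ∈ Ideal.span (t : Set R) := by
    have : x ∈ Ideal.span (𝒜 1 : Set R) := Ideal.subset_span hx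
    change x ∈ Submodule.span R _ at this
    rwa [hspan] at this
  have key : ∀ z ∈ Ideal.span (t : Set R),
      (DirectSum.decompose 𝒜 z 1 : R) ∈ Submodule.span k (t : Set R) := by
    intro z hz
    induction hz using Submodule.span_induction with
    | mem z hz =>
      rw [DirectSum.decompose_of_mem_same 𝒜 (ht hz)]; exact Submodule.subset_span hz
    | zero => simp
    | add a b _ _ ha hb =>
      rw [DirectSum.decompose_add]; exact Submodule.add_mem _ ha hb
    | smul r z hz ih =>
      have hz0 : (DirectSum.decompose 𝒜 z 0 : R) = 0 := by
        rw [← mem_irr, irr_eq_span 𝒜 hstd]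
        exact Ideal.span_mono ht hz
      rw [smul_eq_mul, DirectSum.decompose_mul, DirectSum.coe_mul_apply]
      refine Submodule.sum_mem _ fun p hp => ?_
      have hp2 := (Finset.mem_filter.1 hp).2
      by_cases h : p.2 = 0
      · rw [h, hz0, mul_zero]; exact zero_mem _
      · have h1 : p.1 = 0 := by omega
        have h2 : p.2 = 1 := by omega
        rw [h1, h2]
        have h3 := component_mem_pow' 𝒜 hstd r 0
        rw [pow_zero, Submodule.mem_one] at h3
        obtain ⟨c, hc⟩ := h3
        rw [← hc, ← Algebra.smul_def]
        exact Submodule.smul_mem _ _ ih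
  have := key x hx'
  rwa [DirectSum.decompose_of_mem_same 𝒜 hx] at this

lemma V_fg [IsNoetherianRing R] (hstd : Algebra.adjoin k (𝒜 1 : Set R) = ⊤) :
    (1 ⊔ 𝒜 1 : Submodule k R).FG :=
  Submodule.FG.sup (by rw [Submodule.one_eq_span]; exact Submodule.fg_span_singleton _)
    (deg_one_fg 𝒜 hstd)

lemma lowDeg_fd [IsNoetherianRing R] (hstd : Algebra.adjoin k (𝒜 1 : Set R) = ⊤) (a : ℕ) :
    FiniteDimensional k (lowDeg 𝒜 a) := by
  have : FiniteDimensional k ((1 ⊔ 𝒜 1 : Submodule k R) ^ a : Submodule k R) :=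
    Module.Finite.iff_fg.2 ((V_fg 𝒜 hstd).pow a)
  exact Submodule.finiteDimensional_of_le (lowDeg_le_pow 𝒜 hstd a)

theorem lowDeg_bound [IsNoetherianRing R] (hstd : Algebra.adjoin k (𝒜 1 : Set R) = ⊤) {d : ℕ}
    (φ : MvPolynomial (Fin d) k →ₐ[k] R) (hf : φ.Finite) :
    ∃ C : ℕ, ∀ a, 1 ≤ a → Module.finrank k (lowDeg 𝒜 a) ≤ C * a ^ d := by
  obtain ⟨C, hC⟩ := dim_pow_bound φ hf _ (V_fg 𝒜 hstd)
  refine ⟨C, fun a ha => le_trans ?_ (hC a ha)⟩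
  have : FiniteDimensional k ((1 ⊔ 𝒜 1 : Submodule k R) ^ a : Submodule k R) :=
    Module.Finite.iff_fg.2 ((V_fg 𝒜 hstd).pow a)
  exact Submodule.finrank_mono (lowDeg_le_pow 𝒜 hstd a)

end LowDeg


section Family
variable {k R : Type} [Field k] [CommRing R] [IsDomain R] [Algebra k R]
    (𝒜 : ℕ → Submodule k R) [GradedAlgebra 𝒜]

lemma monomial_lowDeg {d : ℕ} (φ : MvPolynomial (Fin d) k →ₐ[k] R) (b : ℕ)
    (hb : ∀ i, φ (MvPolynomial.X i) ∈ lowDeg 𝒜 b) (N : ℕ) (β : Fin d →₀ ℕ) (hβ : ∀ i, β i ≤ N) :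
    φ (MvPolynomial.monomial β 1) ∈ lowDeg 𝒜 (d * b * N) := by
  classical
  have h1 : φ (MvPolynomial.monomial β 1) = ∏ i, φ (MvPolynomial.X i) ^ β i := by
    rw [MvPolynomial.monomial_eq, MvPolynomial.C_1, one_mul, Finsupp.prod_fintype _ _ (by simp),
      map_prod]
    simp
  have h2 : ∀ s : Finset (Fin d),
      ∏ i ∈ s, φ (MvPolynomial.X i) ^ β i ∈ lowDeg 𝒜 (s.card * (b * N)) := by
    intro s
    induction s using Finset.induction_on with
    | empty => simpa using one_mem_lowDeg 𝒜
    | insert i s hi ih =>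
      rw [Finset.prod_insert hi, Finset.card_insert_of_notMem hi, Nat.succ_mul, add_comm]
      refine mul_mem_lowDeg 𝒜 (lowDeg_mono 𝒜 ?_ (pow_mem_lowDeg 𝒜 (hb i) (β i))) ih
      exact Nat.mul_le_mul_left _ (hβ i)
  have := h2 Finset.univ
  rw [← h1, Finset.card_univ, Fintype.card_fin, ← mul_assoc] at this
  exact this

/-- the truncated family -/
def Tfam (Q : ℕ → Ideal R) (c n : ℕ) : Submodule k R :=
  (Q n).restrictScalars k ⊓ lowDeg 𝒜 (c * n)

theorem family_limit [IsNoetherianRing R] (hstd : Algebra.adjoin k (𝒜 1 : Set R) = ⊤) {d : ℕ}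
    (φ : MvPolynomial (Fin d) k →ₐ[k] R) (hφ : Function.Injective φ) (hf : φ.Finite)
    (f : R) (hf0 : f ≠ 0) (af b : ℕ) (haf : f ∈ lowDeg 𝒜 af)
    (hb : ∀ i, φ (MvPolynomial.X i) ∈ lowDeg 𝒜 b)
    (c : ℕ) (hc1 : 1 ≤ c) (hc : af + d * b ≤ c)
    (Q : ℕ → Ideal R) (hQ0 : Q 0 = ⊤)
    (hQmul : ∀ p q x y, x ∈ Q p → y ∈ Q q → x * y ∈ Q (p + q)) (hfQ : f ∈ Q 1) :
    ∃ L : ℝ, Tendsto (fun n : ℕ => (Module.finrank k (Tfam 𝒜 Q c n) : ℝ) / (n : ℝ) ^ d)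
      atTop (nhds L) := by
  have hle : ∀ n, Tfam 𝒜 Q c n ≤ lowDeg 𝒜 (c * n) := fun n => inf_le_right
  have hfd' : ∀ n, FiniteDimensional k (lowDeg 𝒜 n) := lowDeg_fd 𝒜 hstd
  have hfd : ∀ n, FiniteDimensional k (Tfam 𝒜 Q c n) := fun n =>
    Submodule.finiteDimensional_of_le (hle n)
  have hT1 : (1 : R) ∈ Tfam 𝒜 Q c 0 := by
    refine ⟨?_, one_mem_lowDeg 𝒜⟩
    change (1 : R) ∈ Q 0
    rw [hQ0]; trivial
  have hTmul : ∀ p q x y, x ∈ Tfam 𝒜 Q c p → y ∈ Tfam 𝒜 Q c q → x * y ∈ Tfam 𝒜 Q c (p + q) := by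
    intro p q x y hx hy
    refine ⟨hQmul p q x y hx.1 hy.1, ?_⟩
    rw [mul_add]
    exact mul_mem_lowDeg 𝒜 hx.2 hy.2
  have hfpow : ∀ n, f ^ n ∈ Q n := by
    intro n
    induction n with
    | zero => rw [hQ0]; trivial
    | succ n ih => rw [pow_succ]; exact hQmul _ _ _ _ ih hfQ
  have hfT : f ∈ Tfam 𝒜 Q c 1 := ⟨hfQ, lowDeg_mono 𝒜 (by omega) haf⟩
  have hTh : ∀ N, 0 < N → ∀ β : Fin d →₀ ℕ, (∀ i, β i < N) →
      f ^ N * φ (MvPolynomial.monomial β 1) ∈ Tfam 𝒜 Q c N := by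
    intro N _ β hβ
    refine ⟨(Q N).mul_mem_right _ (hfpow N), ?_⟩
    refine lowDeg_mono 𝒜 ?_ (mul_mem_lowDeg 𝒜 (pow_mem_lowDeg 𝒜 haf N)
      (monomial_lowDeg 𝒜 φ b hb N β fun i => (hβ i).le))
    rw [← add_mul]
    exact Nat.mul_le_mul_right _ hc
  have hphi_int : φ.toRingHom.IsIntegral := RingHom.Finite.to_isIntegral hf
  obtain ⟨C, hC⟩ := lowDeg_bound 𝒜 hstd φ hf
  refine limit_exists d (fun n => Module.finrank k (Tfam 𝒜 Q c n)) ?_ ?_ (C * c ^ d) ?_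
  · intro n _
    have hinj : Function.Injective (LinearMap.mulLeft k f) := fun x y hxy =>
      mul_left_cancel₀ hf0 hxy
    have h1 := (Submodule.equivMapOfInjective (LinearMap.mulLeft k f) hinj
      (Tfam 𝒜 Q c n)).finrank_eq
    have h2 : (Tfam 𝒜 Q c n).map (LinearMap.mulLeft k f) ≤ Tfam 𝒜 Q c (n + 1) := by
      rintro _ ⟨x, hx, rfl⟩
      have := hTmul _ _ _ _ hx hfT
      rw [mul_comm] at this
      exact this
    have h3 := Submodule.finrank_mono h2
    rw [h1]; exact h3
  · intro p _
    exact growth φ hφ hphi_int (Tfam 𝒜 Q c) hfd hT1 hTmul f hf0 hTh p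
  · intro n hn
    have h1 : Module.finrank k (Tfam 𝒜 Q c n) ≤ C * (c * n) ^ d :=
      (Submodule.finrank_mono (hle n)).trans (hC _ (Nat.mul_pos hc1 hn))
    have h2 : ((Module.finrank k (Tfam 𝒜 Q c n) : ℕ) : ℝ) ≤ C * (c * n) ^ d := by exact_mod_cast h1
    rw [mul_pow, ← mul_assoc] at h2
    exact h2

end Family


section Final
variable {k R : Type} [Field k] [CommRing R] [IsDomain R] [Algebra k R]
    (𝒜 : ℕ → Submodule k R) [GradedAlgebra 𝒜]

lemma satI_mul (m I : Ideal R) (p q : ℕ) (x y : R) (hx : x ∈ satI m (I ^ p))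
    (hy : y ∈ satI m (I ^ q)) : x * y ∈ satI m (I ^ (p + q)) := by
  rw [mem_satI] at hx hy ⊢
  obtain ⟨s, hs⟩ := hx
  obtain ⟨t, ht⟩ := hy
  refine ⟨s + t, fun a ha => ?_⟩
  rw [pow_add] at ha ⊢
  induction ha using Submodule.mul_induction_on' with
  | mem_mul_mem a ha b hb =>
    rw [mul_mul_mul_comm]; exact Ideal.mul_mem_mul (hs a ha) (ht b hb)
  | add x _ y _ hx hy => rw [add_mul]; exact Ideal.add_mem _ hx hy

lemma finrank_H0 [IsNoetherianRing R] (hstd : Algebra.adjoin k (𝒜 1 : Set R) = ⊤)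
    {I : Ideal R} (hI : I.IsHomogeneous 𝒜) (c n : ℕ)
    (hc : ∀ a, c * n ≤ a → ∀ u ∈ 𝒜 a, u ∈ satI (irr 𝒜) (I ^ n) → u ∈ I ^ n) :
    Module.finrank k (H0 (M := R ⧸ I ^ n) (irr 𝒜)) +
      Module.finrank k (Tfam 𝒜 (fun n => I ^ n) c n) =
      Module.finrank k (Tfam 𝒜 (fun n => satI (irr 𝒜) (I ^ n)) c n) := by
  classical
  set T := Tfam 𝒜 (fun n => satI (irr 𝒜) (I ^ n)) c n with hT
  set U := Tfam 𝒜 (fun n => I ^ n) c n with hU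
  have hUT : U ≤ T := inf_le_inf_right _ (fun x hx => le_satI (irr 𝒜) (I ^ n) hx)
  have hfd' : ∀ n, FiniteDimensional k (lowDeg 𝒜 n) := lowDeg_fd 𝒜 hstd
  have hfd : FiniteDimensional k T :=
    Submodule.finiteDimensional_of_le (inf_le_right : T ≤ lowDeg 𝒜 (c * n))
  let ψ : T →ₗ[k] H0 (M := R ⧸ I ^ n) (irr 𝒜) :=
    { toFun := fun x => ⟨Ideal.Quotient.mk (I ^ n) x.1, x.2.1⟩
      map_add' := fun x y => Subtype.ext (map_add _ _ _)
      map_smul' := fun a x => Subtype.ext (map_smul (Ideal.Quotient.mkₐ k (I ^ n)) a x.1) }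
  have hker : LinearMap.ker ψ = U.comap T.subtype := by
    ext x
    rw [LinearMap.mem_ker, Submodule.mem_comap]
    constructor
    · intro h
      have h1 : Ideal.Quotient.mk (I ^ n) x.1 = 0 := congrArg Subtype.val h
      exact ⟨Ideal.Quotient.eq_zero_iff_mem.1 h1, x.2.2⟩
    · intro h
      exact Subtype.ext (Ideal.Quotient.eq_zero_iff_mem.2 h.1)
  have hsat : (satI (irr 𝒜) (I ^ n)).IsHomogeneous 𝒜 :=
    satI_homogeneous 𝒜 (ideal_pow_homogeneous 𝒜 hI n) (HomogeneousIdeal.isHomogeneous _)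
  have hsurj : Function.Surjective ψ := by
    rintro ⟨z, hz⟩
    obtain ⟨x, rfl⟩ := Ideal.Quotient.mk_surjective z
    have hx : x ∈ satI (irr 𝒜) (I ^ n) := hz
    let s := (DirectSum.decompose 𝒜 x).support
    let x' := ∑ i ∈ s with i ≤ c * n, (DirectSum.decompose 𝒜 x i : R)
    have hx' : x' ∈ T := by
      constructor
      · exact Ideal.sum_mem _ fun i _ => hsat i hx
      · exact Submodule.sum_mem _ fun i hi =>
          mem_lowDeg_of_mem 𝒜 (Finset.mem_filter.1 hi).2 (SetLike.coe_mem _)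
    refine ⟨⟨x', hx'⟩, Subtype.ext ?_⟩
    change Ideal.Quotient.mk (I ^ n) x' = Ideal.Quotient.mk (I ^ n) x
    symm
    rw [Ideal.Quotient.eq]
    have h1 : x - x' = ∑ i ∈ s with ¬ i ≤ c * n, (DirectSum.decompose 𝒜 x i : R) := by
      rw [sub_eq_iff_eq_add']
      conv_lhs => rw [← DirectSum.sum_support_decompose 𝒜 x]
      exact (Finset.sum_filter_add_sum_filter_not _ _ _).symm
    rw [h1]
    refine Ideal.sum_mem _ fun i hi => ?_
    exact hc i (not_le.1 (Finset.mem_filter.1 hi).2).le _ (SetLike.coe_mem _) (hsat i hx)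
  have h1 := LinearMap.finrank_range_add_finrank_ker ψ
  rw [LinearMap.range_eq_top.2 hsurj, finrank_top, hker,
    (Submodule.comapSubtypeEquivOfLe hUT).finrank_eq] at h1
  exact h1

lemma H0_bot (hbot : irr 𝒜 ≠ ⊥) : Module.finrank k (H0 (M := R ⧸ (⊥ : Ideal R)) (irr 𝒜)) = 0 := by
  have h : H0 (M := R ⧸ (⊥ : Ideal R)) (irr 𝒜) = ⊥ := by
    rw [eq_bot_iff]
    intro z hz
    obtain ⟨x, rfl⟩ := Ideal.Quotient.mk_surjective z
    have hx : x ∈ satI (irr 𝒜) (⊥ : Ideal R) := hz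
    rw [mem_satI] at hx
    obtain ⟨n, hn⟩ := hx
    obtain ⟨a, ha, ha0⟩ := Submodule.exists_mem_ne_zero_of_ne_bot hbot
    have h1 := hn (a ^ n) (Ideal.pow_mem_pow ha n)
    rw [Ideal.mem_bot] at h1
    have h2 : x = 0 := (mul_eq_zero.1 h1).resolve_left (pow_ne_zero n ha0)
    rw [h2, map_zero]; exact zero_mem _
  rw [h]
  exact finrank_bot k _

theorem partB (hFG : Algebra.FiniteType k R)
    (hstd : Algebra.adjoin k (𝒜 1 : Set R) = ⊤)
    (d : ℕ) (hd : ringKrullDim R = d) (hbot : irr 𝒜 ≠ ⊥)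
    (I : Ideal R) (hI : I.IsHomogeneous 𝒜) :
    ∃ L : ℝ, Tendsto (fun n : ℕ =>
        (Module.finrank k (H0 (M := R ⧸ I ^ n) (irr 𝒜)) : ℝ) / (n : ℝ) ^ d) atTop (nhds L) := by
  have hN : IsNoetherianRing R := Algebra.FiniteType.isNoetherianRing k R
  by_cases hI0 : I = ⊥
  · refine ⟨0, tendsto_const_nhds.congr' ?_⟩
    filter_upwards [eventually_ge_atTop 1] with n hn
    have h1 : I ^ n = ⊥ := by rw [hI0]; exact Ideal.bot_pow (by omega)
    rw [h1, H0_bot 𝒜 hbot]; simp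
  obtain ⟨f, hfI, hf0⟩ := Submodule.exists_mem_ne_zero_of_ne_bot hI0
  obtain ⟨φ, hφ, hfin⟩ := noether_norm hFG d hd
  obtain ⟨af, haf⟩ := exists_lowDeg 𝒜 f
  choose b hb using fun i => exists_lowDeg 𝒜 (φ (MvPolynomial.X i))
  have hb' : ∀ i, φ (MvPolynomial.X i) ∈ lowDeg 𝒜 (Finset.univ.sup b) := fun i =>
    lowDeg_mono 𝒜 (Finset.le_sup (Finset.mem_univ i)) (hb i)
  obtain ⟨c₀, hc₀⟩ := degree_bound 𝒜 hstd hI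
  let c := c₀ + (af + d * Finset.univ.sup b) + 1
  obtain ⟨L₁, hL₁⟩ := family_limit 𝒜 hstd φ hφ hfin f hf0 af _ haf hb' c (by omega) (by omega)
    (fun n => satI (irr 𝒜) (I ^ n))
    (by rw [pow_zero, Ideal.one_eq_top]; exact top_le_iff.1 (le_satI _ _))
    (satI_mul (irr 𝒜) I) (le_satI _ _ (by rwa [pow_one]))
  obtain ⟨L₂, hL₂⟩ := family_limit 𝒜 hstd φ hφ hfin f hf0 af _ haf hb' c (by omega) (by omega)
    (fun n => I ^ n) (by rw [pow_zero, Ideal.one_eq_top])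
    (fun p q x y hx hy => by
      change x * y ∈ I ^ (p + q)
      rw [pow_add]; exact Ideal.mul_mem_mul hx hy) (by rwa [pow_one])
  refine ⟨L₁ - L₂, (hL₁.sub hL₂).congr' ?_⟩
  filter_upwards [eventually_ge_atTop 1] with n hn
  have h1 := finrank_H0 𝒜 hstd hI c n (fun a ha => hc₀ n hn a
    (le_trans (Nat.mul_le_mul_right _ (by omega)) ha))
  rw [← h1]
  push_cast
  ring

end Final

theorem statement2 (k : Type) [Field k] [CharZero k]
    (R : Type) [CommRing R] [IsDomain R] [Algebra k R]
    (𝒜 : ℕ → Submodule k R) [GradedAlgebra 𝒜]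
    -- `R` is a quotient of a polynomial ring by a homogeneous prime ideal
    (hFG : Algebra.FiniteType k R)
    (hstd : Algebra.adjoin k (𝒜 1 : Set R) = ⊤)
    (m : Ideal R) (hm : m = (HomogeneousIdeal.irrelevant 𝒜).toIdeal)
    (d : ℕ) (hd : ringKrullDim R = d)
    -- `depth (R_m) ≥ 2`
    (hdepth : ∃ a b : R, a ∈ m ∧ b ∈ m ∧ RingTheory.Sequence.IsRegular R [a, b])
    -- `R` is Gorenstein (Bass characterization at the maximal homogeneous ideal)
    (hGor : ∀ i : ℕ,
      kLength k (extModule R i (ModuleCat.of R (R ⧸ m)) (ModuleCat.of R R)) =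
        if i = d then 1 else 0)
    -- a homogeneous ideal
    (I : Ideal R) (hI : I.IsHomogeneous 𝒜) :
    ∃ L : ℝ,
      Tendsto (fun n : ℕ =>
          (Module.finrank k (H0 (M := R ⧸ I ^ n) m) : ℝ) / (n : ℝ) ^ d)
        atTop (nhds L) ∧
      Tendsto (fun n : ℕ =>
          (kLength k (extModule R d (ModuleCat.of R (R ⧸ I ^ n)) (ModuleCat.of R R)) : ℝ) /
            (n : ℝ) ^ d)
        atTop (nhds L) := by
  subst hm
  obtain ⟨L, hL⟩ := partB 𝒜 hFG hstd d hd (irr_ne_bot 𝒜 hdepth) I hI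
  refine ⟨L, hL, hL.congr fun n => ?_⟩
  rw [partA 𝒜 hFG hstd d hd hdepth hGor (I ^ n) (ideal_pow_homogeneous 𝒜 hI n)]
end

section
/- Let R be a domain which is a finitely generated graded k-algebra of (Krull) dimension δ, and let I ⊆ R be a homogeneous ideal generated in degrees ≤ d with ht I ≥ 1. Let A = R[It] be the Rees algebra of I, bigraded by A_{(m,n)} = (I^n)_m t^n. Then for every pair Δ = (a,b) of positive integers with a > db, the diagonal subalgebra A_Δ = ⊕_{n∈ℤ} A_{(an,bn)} has Krull dimension δ. -/
/-!
STATEMENT 4: Let `R` be a domain which is a finitely generated graded `k`-algebra of Krull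
dimension `δ`, and let `I ⊆ R` be a homogeneous ideal generated in degrees `≤ d` with
`ht I ≥ 1`.  Let `A = R[It]` be the Rees algebra of `I`, bigraded by `A_{(m,n)} = (Iⁿ)_m tⁿ`.
Then for every pair `Δ = (a,b)` of positive integers with `a > d·b`, the diagonal subalgebra
`A_Δ = ⊕_{n} A_{(an,bn)}` has Krull dimension `δ`.

We realize the Rees algebra inside the polynomial ring `R[t]`, so the diagonal
`A_Δ = ⊕_n (I^{bn})_{an} t^{bn}` is a `k`-submodule of `R[t]`; the conclusion is stated for
the `k`-subalgebra of `R[t]` whose underlying module is this diagonal.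
-/

/-- Height of an ideal: the infimum of the heights of the primes containing it. -/
noncomputable def idealHeight {R : Type*} [CommRing R] (I : Ideal R) : ℕ∞ :=
  ⨅ (p : PrimeSpectrum R) (_ : I ≤ p.asIdeal), Order.height p

/-- The `(a,b)`-diagonal `⊕_{n} (I^{bn})_{an} t^{bn}` of the bigraded Rees algebra `R[It]`,
realized as a `k`-submodule of `R[t]`. -/
noncomputable def diagonal (k : Type*) {R : Type*} [Field k] [CommRing R] [Algebra k R]
    (𝒜 : ℕ → Submodule k R) (I : Ideal R) (a b : ℕ) : Submodule k (Polynomial R) :=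
  ⨆ n : ℕ, Submodule.map
    ((Polynomial.monomial (b * n) : R →ₗ[R] Polynomial R).restrictScalars k)
    ((Submodule.restrictScalars k (I ^ (b * n) : Ideal R)) ⊓ 𝒜 (a * n))



theorem dim_integral_aux (A B : Type) [CommRing A] [CommRing B] [Algebra A B] [FaithfulSMul A B]
    [Algebra.IsIntegral A B] : ringKrullDim A = ringKrullDim B := by
  apply le_antisymm
  · refine iSup_le fun l => ?_
    obtain ⟨Q, hQ, hQ2⟩ := Ideal.exists_ideal_over_prime_of_isIntegral (S := B) (RelSeries.head l).asIdeal ⊥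
      (by
        intro x hx
        have : x = 0 := by
          apply FaithfulSMul.algebraMap_injective A B
          simpa using hx
        simp [this])
    have : Q.LiesOver (RelSeries.head l).asIdeal := ⟨hQ2.2.symm⟩
    have := hQ2.1
    obtain ⟨L, hL, -⟩ := Ideal.exists_ltSeries_of_hasGoingUp (S := B) l Q
    rw [← hL]
    exact Order.LTSeries.length_le_krullDim L
  · refine Order.krullDim_le_of_strictMono (PrimeSpectrum.comap (algebraMap A B)) ?_
    intro p q h
    exact Ideal.IsIntegral.comap_lt_comap (R := A) (I := p.asIdeal) (J := q.asIdeal) h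

theorem dim_fg_aux (k T : Type) [Field k] [CommRing T] [IsDomain T] [Algebra k T]
    [Algebra.FiniteType k T] : ∃ n : ℕ, ringKrullDim T = n ∧ Algebra.trdeg k T = n := by
  obtain ⟨n, g, hg, hi⟩ := exists_integral_inj_algHom_of_fg k T
  algebraize [g.toRingHom]
  have : FaithfulSMul (MvPolynomial (Fin n) k) T := (faithfulSMul_iff_algebraMap_injective _ _).2 hg
  have : IsScalarTower k (MvPolynomial (Fin n) k) T := .of_algebraMap_eq fun x => (g.commutes x).symm
  refine ⟨n, ?_, ?_⟩
  · rw [← dim_integral_aux (MvPolynomial (Fin n) k) T, MvPolynomial.ringKrullDim_of_isNoetherianRing]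
    simp
  · rw [← _root_.trdeg_add_eq k (MvPolynomial (Fin n) k) (A := T)]
    simp [_root_.trdeg_eq_zero]

theorem dim_le_trdeg_aux (k T : Type) [Field k] [CommRing T] [IsDomain T] [Algebra k T] (n : ℕ)
    (h : Algebra.trdeg k T ≤ n) : ringKrullDim T ≤ n := by
  refine iSup_le fun l => ?_
  have hx : ∀ i : Fin l.length, ∃ x : T, x ∈ (l i.succ).asIdeal ∧ x ∉ (l i.castSucc).asIdeal := by
    intro i
    have := l.step i
    exact Set.exists_of_ssubset (show (l i.castSucc).asIdeal < (l i.succ).asIdeal from this)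
  choose x hx1 hx2 using hx
  let T' := Algebra.adjoin k (Set.range x)
  have : Algebra.FiniteType k T' := (Subalgebra.fg_iff_finiteType _).1 (Subalgebra.fg_def.2 ⟨_, Set.finite_range x, rfl⟩)
  obtain ⟨m, hm1, hm2⟩ := dim_fg_aux k T'
  have hmn : m ≤ n := by
    have := (_root_.trdeg_le_of_injective T'.val Subtype.val_injective).trans h
    rw [hm2] at this
    exact_mod_cast this
  let l' : LTSeries (PrimeSpectrum T') := 
    { length := l.length
      toFun := fun i => PrimeSpectrum.comap (algebraMap T' T) (l i)
      step := fun i => by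
        have h1 := (show l i.castSucc < l i.succ from l.step i).le
        refine (show PrimeSpectrum.comap (algebraMap T' T) (l i.castSucc) < PrimeSpectrum.comap (algebraMap T' T) (l i.succ) from ?_)
        refine lt_of_le_not_ge (fun z hz => h1 hz) fun h2 => ?_
        have := @h2 ⟨x i, Algebra.subset_adjoin ⟨i, rfl⟩⟩ (hx1 i)
        exact hx2 i this }
  have := (Order.LTSeries.length_le_krullDim l').trans hm1.le
  refine this.trans ?_
  exact_mod_cast hmn

theorem dim_eq_of_algebraic_aux (k S R : Type) [Field k] [CommRing S] [CommRing R] [IsDomain S] [IsDomain R]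
    [Algebra k S] [Algebra k R] [Algebra S R] [IsScalarTower k S R] [FaithfulSMul S R]
    [Algebra.FiniteType k R] [Algebra.IsAlgebraic S R] : ringKrullDim S = ringKrullDim R := by
  classical
  obtain ⟨n, hn1, hn2⟩ := dim_fg_aux k R
  apply le_antisymm
  · rw [hn1]
    apply dim_le_trdeg_aux k
    rw [← hn2]
    exact _root_.trdeg_le_of_injective (IsScalarTower.toAlgHom k S R) (FaithfulSMul.algebraMap_injective S R)
  have : Algebra.FiniteType S R := Algebra.FiniteType.of_restrictScalars_finiteType k S R
  obtain ⟨G, hG⟩ := this.out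
  have hy : ∀ z : R, ∃ y ≠ (0 : S), IsIntegral S (y • z) := fun z =>
    (Algebra.IsAlgebraic.isAlgebraic z).exists_integral_multiple
  choose y hy0 hyi using hy
  let s := ∏ z ∈ G, y z
  have hs : s ≠ 0 := Finset.prod_ne_zero_iff.2 fun z _ => hy0 z
  let Ss := Localization.Away s
  let Rs := Localization.Away (algebraMap S R s)
  have hs' : algebraMap S R s ≠ 0 := by simpa using hs
  have : IsDomain Rs := IsLocalization.isDomain_localization (powers_le_nonZeroDivisors_of_noZeroDivisors hs')
  have : IsDomain Ss := IsLocalization.isDomain_localization (powers_le_nonZeroDivisors_of_noZeroDivisors hs)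
  have : FaithfulSMul R Rs := (faithfulSMul_iff_algebraMap_injective _ _).2 
    (IsLocalization.injective _ (powers_le_nonZeroDivisors_of_noZeroDivisors hs'))
  have : FaithfulSMul S Ss := (faithfulSMul_iff_algebraMap_injective _ _).2 
    (IsLocalization.injective _ (powers_le_nonZeroDivisors_of_noZeroDivisors hs))
  have : Algebra.FiniteType R Rs := IsLocalization.finiteType_of_monoid_fg (.powers (algebraMap S R s)) Rs
  have : Algebra.FiniteType k Rs := Algebra.FiniteType.trans (S := R) inferInstance inferInstance
  have : Algebra.IsAlgebraic R Rs := IsLocalization.isAlgebraic Rs (.powers (algebraMap S R s))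
  have hRs : ringKrullDim Rs = ringKrullDim R := by
    obtain ⟨m, hm1, hm2⟩ := dim_fg_aux k Rs
    rw [hm1, hn1]
    have := _root_.trdeg_add_eq k R (A := Rs)
    rw [hn2, hm2, _root_.trdeg_eq_zero, add_zero] at this
    have : n = m := by exact_mod_cast this
    rw [this]
  let φ : Ss →+* Rs := IsLocalization.Away.lift (g := algebraMap S Rs) s (by
    rw [IsScalarTower.algebraMap_apply S R Rs]
    exact IsLocalization.Away.algebraMap_isUnit _)
  algebraize [φ]
  have hφ : ∀ x : S, φ (algebraMap S Ss x) = algebraMap S Rs x := fun x => by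
    simp [φ]
  have : IsScalarTower S Ss Rs := .of_algebraMap_eq fun x => (hφ x).symm
  have hinj : Function.Injective φ := by
    rw [injective_iff_map_eq_zero]
    intro x hx
    obtain ⟨⟨u, v⟩, huv⟩ := IsLocalization.surj (Submonoid.powers s) x
    simp only at huv
    have h1 : φ (algebraMap S Ss u) = 0 := by rw [← huv, map_mul, hx, zero_mul]
    rw [hφ, IsScalarTower.algebraMap_apply S R Rs] at h1
    have h2 : u = 0 := by simpa using h1
    rw [h2, map_zero] at huv
    rcases mul_eq_zero.1 huv with h | h
    · exact h
    · exact absurd ((IsLocalization.map_units Ss v)) (by rw [h]; simp)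
  have : FaithfulSMul Ss Rs := (faithfulSMul_iff_algebraMap_injective _ _).2 hinj
  have hgen : ∀ r : R, IsIntegral Ss (algebraMap R Rs r) := by
    intro r
    have hr : r ∈ Algebra.adjoin S (G : Set R) := hG ▸ trivial
    induction hr using Algebra.adjoin_induction with
    | mem z hz =>
      have h1 : IsIntegral Ss (algebraMap R Rs (y z • z)) :=
        ((hyi z).map (IsScalarTower.toAlgHom S R Rs)).tower_top
      have hu : IsUnit (algebraMap S Ss (y z)) := by
        have : IsUnit (algebraMap S Ss s) := IsLocalization.Away.algebraMap_isUnit s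
        exact isUnit_of_dvd_unit (map_dvd _ (Finset.dvd_prod_of_mem y hz)) this
      obtain ⟨u, hu⟩ := hu
      have h2 := h1.smul (u⁻¹ : Ssˣ).val
      convert h2 using 1
      rw [Algebra.smul_def (y z), map_mul, ← IsScalarTower.algebraMap_apply S R Rs,
        IsScalarTower.algebraMap_apply S Ss Rs, ← hu, ← Algebra.smul_def, smul_smul]
      simp
    | algebraMap x =>
      rw [← IsScalarTower.algebraMap_apply S R Rs, IsScalarTower.algebraMap_apply S Ss Rs]
      exact isIntegral_algebraMap
    | add x y _ _ hx hy => rw [map_add]; exact hx.add hy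
    | mul x y _ _ hx hy => rw [map_mul]; exact hx.mul hy
  have : Algebra.IsIntegral Ss Rs := by
    refine ⟨fun x => ?_⟩
    obtain ⟨⟨r, v⟩, hr⟩ := IsLocalization.surj (Submonoid.powers (algebraMap S R s)) x
    obtain ⟨v, N, rfl⟩ := v
    simp only at hr
    have : IsUnit (algebraMap S Ss (s ^ N)) := by
      rw [map_pow]; exact (IsLocalization.Away.algebraMap_isUnit s).pow N
    obtain ⟨u, hu⟩ := this
    have h2 := (hgen r).smul (u⁻¹ : Ssˣ).val
    convert h2 using 1
    rw [← hr, ← map_pow, ← IsScalarTower.algebraMap_apply S R Rs,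
        IsScalarTower.algebraMap_apply S Ss Rs, ← hu, mul_comm, ← Algebra.smul_def, smul_smul]
    simp
  rw [← hRs, ← dim_integral_aux Ss Rs]
  refine Order.krullDim_le_of_strictMono (PrimeSpectrum.comap (algebraMap S Ss)) ?_
  intro p q h
  exact (IsLocalization.orderEmbedding (Submonoid.powers s) Ss).strictMono h

theorem diagonal_mem_gen {k R : Type} [Field k] [CommRing R] [Algebra k R]
    (𝒜 : ℕ → Submodule k R) (I : Ideal R) (a b n : ℕ) (x : R) (h1 : x ∈ I ^ (b * n))
    (h2 : x ∈ 𝒜 (a * n)) : Polynomial.monomial (b * n) x ∈ diagonal k 𝒜 I a b :=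
  Submodule.mem_iSup_of_mem n ⟨x, ⟨h1, h2⟩, rfl⟩

theorem diagonal_ind {k R : Type} [Field k] [CommRing R] [Algebra k R]
    (𝒜 : ℕ → Submodule k R) (I : Ideal R) (a b : ℕ) {P : Polynomial R → Prop}
    (h0 : P 0) (hadd : ∀ p q, P p → P q → P (p + q))
    (hm : ∀ n x, x ∈ I ^ (b * n) → x ∈ 𝒜 (a * n) → P (Polynomial.monomial (b * n) x))
    (p : Polynomial R) (hp : p ∈ diagonal k 𝒜 I a b) : P p := by
  refine Submodule.iSup_induction _ (motive := P) hp ?_ h0 hadd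
  rintro n _ ⟨x, ⟨h1, h2⟩, rfl⟩
  exact hm n x h1 h2

/-- The diagonal as a subalgebra. -/
noncomputable def diagonalSubalgebra (k : Type) {R : Type} [Field k] [CommRing R] [Algebra k R]
    (𝒜 : ℕ → Submodule k R) [GradedAlgebra 𝒜] (I : Ideal R) (a b : ℕ) :
    Subalgebra k (Polynomial R) :=
  (diagonal k 𝒜 I a b).toSubalgebra
    (by
      have := diagonal_mem_gen 𝒜 I a b 0 1 (by simp) (by simpa using SetLike.GradedOne.one_mem)
      simpa using this)
    (by
      intro p q hp hq
      refine diagonal_ind 𝒜 I a b (P := fun p => p * q ∈ diagonal k 𝒜 I a b) (by simp)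
        (fun p p' h h' => by rw [add_mul]; exact add_mem h h') ?_ p hp
      intro n x hx1 hx2
      refine diagonal_ind 𝒜 I a b
        (P := fun q => Polynomial.monomial (b * n) x * q ∈ diagonal k 𝒜 I a b) (by simp)
        (fun p p' h h' => by rw [mul_add]; exact add_mem h h') ?_ q hq
      intro m y hy1 hy2
      rw [Polynomial.monomial_mul_monomial, ← mul_add]
      refine diagonal_mem_gen 𝒜 I a b (n + m) _ ?_ ?_
      · rw [mul_add, pow_add]; exact Ideal.mul_mem_mul hx1 hy1
      · rw [mul_add]; exact SetLike.mul_mem_graded hx2 hy2)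

theorem diagonal_coeff {k R : Type} [Field k] [CommRing R] [Algebra k R]
    (𝒜 : ℕ → Submodule k R) [GradedAlgebra 𝒜] (I : Ideal R) (a b : ℕ) (ha : 0 < a) (hb : 0 < b)
    (p : Polynomial R) (hp : p ∈ diagonal k 𝒜 I a b) :
    (∀ n, p.coeff (b * n) = DirectSum.decompose 𝒜 (p.eval 1) (a * n)) ∧
      ∀ m, ¬ b ∣ m → p.coeff m = 0 := by
  refine diagonal_ind 𝒜 I a b (P := fun p =>
    (∀ n, p.coeff (b * n) = DirectSum.decompose 𝒜 (p.eval 1) (a * n)) ∧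
      ∀ m, ¬ b ∣ m → p.coeff m = 0) (by simp) ?_ ?_ p hp
  · rintro p q ⟨h1, h2⟩ ⟨h3, h4⟩
    refine ⟨fun n => ?_, fun m hm => ?_⟩
    · simp [h1, h3]
    · simp [h2 m hm, h4 m hm]
  · intro n x hx1 hx2
    refine ⟨fun m => ?_, fun m hm => ?_⟩
    · rw [Polynomial.coeff_monomial, Polynomial.eval_monomial, one_pow, mul_one]
      split_ifs with h
      · have : n = m := Nat.eq_of_mul_eq_mul_left hb h
        subst this
        rw [DirectSum.decompose_of_mem_same 𝒜 hx2]
      · rw [DirectSum.decompose_of_mem_ne 𝒜 hx2]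
        intro h'
        exact h (by rw [Nat.eq_of_mul_eq_mul_left ha h'])
    · rw [Polynomial.coeff_monomial, if_neg]
      rintro rfl
      exact hm ⟨n, rfl⟩

theorem statement4 (k : Type) [Field k]
    (R : Type) [CommRing R] [IsDomain R] [Algebra k R]
    (𝒜 : ℕ → Submodule k R) [GradedAlgebra 𝒜]
    (hFG : Algebra.FiniteType k R)
    -- `δ` is the Krull dimension of `R`
    (δ : ℕ) (hδ : ringKrullDim R = δ)
    (I : Ideal R) (hI : I.IsHomogeneous 𝒜)
    -- `I` is generated in degrees `≤ d`
    (d : ℕ) (hgen : ∃ s : Finset R, (∀ f ∈ s, ∃ i ≤ d, f ∈ 𝒜 i) ∧ I = Ideal.span ↑s)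
    -- `ht I ≥ 1`
    (hht : 1 ≤ idealHeight I)
    (a b : ℕ) (ha : 0 < a) (hb : 0 < b) (hab : d * b < a) :
    ∃ S : Subalgebra k (Polynomial R),
      Subalgebra.toSubmodule S = diagonal k 𝒜 I a b ∧ ringKrullDim S = δ := by
  refine ⟨diagonalSubalgebra k 𝒜 I a b, rfl, ?_⟩
  -- a nonzero homogeneous element of `I` of small degree
  obtain ⟨f, i, hf0, hfI, hid, hfi⟩ : ∃ f i, f ≠ 0 ∧ f ∈ I ∧ i ≤ d ∧ f ∈ 𝒜 i := by
    obtain ⟨s, hs, rfl⟩ := hgen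
    by_contra! hcon
    have hbot : Ideal.span (s : Set R) = ⊥ := by
      rw [Ideal.span_eq_bot]
      intro f hf
      by_contra hf0
      obtain ⟨i, hi, hfi⟩ := hs f hf
      exact hcon f i hf0 (Ideal.subset_span hf) hi hfi
    have h1 : idealHeight (Ideal.span (s : Set R)) ≤ Order.height (⟨⊥, Ideal.isPrime_bot⟩ : PrimeSpectrum R) :=
      iInf₂_le (⟨⊥, Ideal.isPrime_bot⟩ : PrimeSpectrum R) hbot.le
    have h2 : Order.height (⟨⊥, Ideal.isPrime_bot⟩ : PrimeSpectrum R) = 0 :=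
      Order.height_eq_zero.2 fun q _ => (bot_le : (⊥ : Ideal R) ≤ q.asIdeal)
    rw [h2] at h1
    exact absurd (hht.trans h1) (by simp)
  let S := diagonalSubalgebra k 𝒜 I a b
  let φ : S →ₐ[k] R := ((Polynomial.aeval (R := R) (1 : R)).restrictScalars k).comp S.val
  have hφ : ∀ p : S, φ p = (p : Polynomial R).eval 1 := fun p => by
    simp [φ]
  have hinj : Function.Injective φ := by
    rw [injective_iff_map_eq_zero]
    intro p hp
    rw [hφ] at hp
    obtain ⟨h1, h2⟩ := diagonal_coeff 𝒜 I a b ha hb p.1 p.2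
    apply Subtype.ext
    ext m
    by_cases hm : b ∣ m
    · obtain ⟨n, rfl⟩ := hm
      rw [h1, hp]; simp
    · rw [h2 m hm]; simp
  let _ : Algebra S R := φ.toRingHom.toAlgebra
  have : IsScalarTower k S R := .of_algebraMap_eq fun x => (φ.commutes x).symm
  have : FaithfulSMul S R := (faithfulSMul_iff_algebraMap_injective _ _).2 hinj
  have halg : ∀ n x, x ∈ I ^ (b * n) → x ∈ 𝒜 (a * n) → IsAlgebraic S x := by
    intro n x h1 h2
    have h3 := isAlgebraic_algebraMap (R := S) (A := R) ⟨_, diagonal_mem_gen 𝒜 I a b n x h1 h2⟩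
    have h4 : algebraMap S R ⟨_, diagonal_mem_gen 𝒜 I a b n x h1 h2⟩ = x := by
      refine (hφ _).trans ?_
      simp
    rwa [h4] at h3
  obtain ⟨c, hc, hac⟩ : ∃ c, 0 < c ∧ a = b * i + c := by
    have : b * i ≤ d * b := by rw [mul_comm]; exact Nat.mul_le_mul_right b hid
    exact ⟨a - b * i, by omega, by omega⟩
  have hpos : ∀ e y, 0 < e → y ≠ 0 → y ∈ 𝒜 e → IsAlgebraic S y := by
    intro e y he hy0 hy
    have hu : IsAlgebraic S (f ^ (b * e) * y ^ c) := by
      refine halg e _ (Ideal.mul_mem_right _ _ (Ideal.pow_mem_pow hfI _)) ?_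
      have := SetLike.mul_mem_graded (SetLike.pow_mem_graded (b * e) hfi)
        (SetLike.pow_mem_graded c hy)
      convert this using 2
      simp only [smul_eq_mul, hac]; ring
    obtain ⟨c', rfl⟩ : ∃ c', c = c' + 1 := ⟨c - 1, by omega⟩
    have hv : IsAlgebraic S (f ^ (b * (e * i)) * f ^ e * y ^ (c' * i)) := by
      refine halg (e * i) _ (Ideal.mul_mem_right _ _ (Ideal.mul_mem_right _ _
        (Ideal.pow_mem_pow hfI _))) ?_
      have := SetLike.mul_mem_graded (SetLike.mul_mem_graded
        (SetLike.pow_mem_graded (b * (e * i)) hfi) (SetLike.pow_mem_graded e hfi))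
        (SetLike.pow_mem_graded (c' * i) hy)
      convert this using 2
      simp only [smul_eq_mul, hac]; ring
    refine IsAlgebraic.of_pow ha (IsAlgebraic.of_mul
      (y := (f ^ (b * (e * i)) * f ^ e * y ^ (c' * i)) ^ b) ?_ (hv.pow b) ?_)
    · exact mem_nonZeroDivisors_of_ne_zero (by simp [hf0, hy0])
    · convert hu.pow (i * b + 1) using 1
      rw [hac]; ring
  have : Algebra.IsAlgebraic S R := by
    refine ⟨fun r => ?_⟩
    refine DirectSum.Decomposition.inductionOn 𝒜 (motive := fun r => IsAlgebraic S r)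
      isAlgebraic_zero ?_ (fun x y hx hy => hx.add hy) r
    rintro e ⟨y, hy⟩
    rcases Nat.eq_zero_or_pos e with rfl | he
    · exact halg 0 y (by simp) (by simpa using hy)
    · by_cases hy0 : y = 0
      · simpa [hy0] using isAlgebraic_zero
      · exact hpos e y he hy0 hy
  rw [← hδ]
  exact dim_eq_of_algebraic_aux k S R
end
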